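/- For every odd integer ℓ ≥ 1 there is a constant c > 0 depending only on ℓ such that for every n ≥ 3 and every a = (a_1,…,a_n) ∈ ℝ^n with Σ_{i=1}^n a_i² = 1, the function p: S^{n-1} → ℝ defined by p(x) = Σ_{i=1}^n a_i p_ℓ^{(i)}(x) satisfies d_TV(p(X), Z) ≤ c · ‖a‖₄², where ‖a‖₄ = (Σ_i a_i⁴)^{1/4}. -/

import Mathlib

open MeasureTheory ProbabilityTheory Real Finset

noncomputable section

/-- total variation distance between two (Borel) measures on ℝ -/
def dTV (μ ν : MeasureTheory.Measure ℝ) : ℝ :=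
  ⨆ s : {s : Set ℝ // MeasurableSet s}, |(μ s.1).toReal - (ν s.1).toReal|

/-- uniform probability measure on the unit sphere of a Euclidean space -/
def sphereUniform (ι : Type*) [Fintype ι] :
    MeasureTheory.Measure (Metric.sphere (0 : EuclideanSpace ℝ ι) 1) :=
  ((volume : MeasureTheory.Measure (EuclideanSpace ℝ ι)).toSphere Set.univ)⁻¹ •
    (volume : MeasureTheory.Measure (EuclideanSpace ℝ ι)).toSphere

/-- The Gegenbauer polynomial `C^k_m(t)`. -/
def gegenbauer (k : ℝ) (m : ℕ) (t : ℝ) : ℝ :=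
  (2 ^ m / Real.Gamma k) * ∑ j ∈ Finset.range (m / 2 + 1),
    ((-1 : ℝ) ^ j * Real.Gamma (k + m - j) * t ^ (m - 2 * j)) /
      (2 ^ (2 * j) * (Nat.factorial j) * (Nat.factorial (m - 2 * j)))

/-- The normalizing constant `A_{n,ℓ}`, with `A² = (n−3)!ℓ!(n+2ℓ−2)/((n+ℓ−3)!(n−2))`. -/
def Aconst (n ℓ : ℕ) : ℝ :=
  Real.sqrt (((Nat.factorial (n - 3) : ℝ) * Nat.factorial ℓ * (n + 2 * ℓ - 2)) /
    ((Nat.factorial (n + ℓ - 3) : ℝ) * (n - 2)))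

/-- The eigenfunction `p_ℓ^{(i)}(x) = A_{n,ℓ} C^{(n-2)/2}_ℓ(x_i)`. -/
def pli (n ℓ : ℕ) (i : Fin n) (x : EuclideanSpace ℝ (Fin n)) : ℝ :=
  Aconst n ℓ * gegenbauer (((n : ℝ) - 2) / 2) ℓ (x i)

section SphereRotation

open scoped Pointwise

variable {ι : Type*} [Fintype ι]

instance isProbabilityMeasure_sphereUniform [Nonempty ι] :
    IsProbabilityMeasure (sphereUniform ι) := by
  refine ⟨?_⟩
  rw [sphereUniform, Measure.smul_apply, smul_eq_mul]
  refine ENNReal.inv_mul_cancel ?_ (measure_ne_top _ _)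
  rw [Ne, Measure.measure_univ_eq_zero]
  exact Measure.toSphere_ne_zero _

/-- The restriction of a linear isometry to the unit sphere. -/
def sphereMap (R : EuclideanSpace ℝ ι ≃ₗᵢ[ℝ] EuclideanSpace ℝ ι)
    (x : Metric.sphere (0 : EuclideanSpace ℝ ι) 1) :
    Metric.sphere (0 : EuclideanSpace ℝ ι) 1 :=
  ⟨R x, by simp⟩

lemma continuous_sphereMap (R : EuclideanSpace ℝ ι ≃ₗᵢ[ℝ] EuclideanSpace ℝ ι) :
    Continuous (sphereMap R) :=
  (R.continuous.comp continuous_subtype_val).subtype_mk _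

lemma measurePreserving_sphereMap (R : EuclideanSpace ℝ ι ≃ₗᵢ[ℝ] EuclideanSpace ℝ ι) :
    MeasurePreserving (sphereMap R) (sphereUniform ι) (sphereUniform ι) := by
  refine ⟨(continuous_sphereMap R).measurable, ?_⟩
  ext s hs
  have hs' := (continuous_sphereMap R).measurable hs
  rw [Measure.map_apply (continuous_sphereMap R).measurable hs, sphereUniform,
    Measure.smul_apply, Measure.smul_apply, Measure.toSphere_apply' _ hs,
    Measure.toSphere_apply' _ hs']
  congr 2
  have hset : Set.Ioo (0 : ℝ) 1 • ((↑) '' (sphereMap R ⁻¹' s) : Set (EuclideanSpace ℝ ι)) =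
      R ⁻¹' (Set.Ioo (0 : ℝ) 1 • ((↑) '' s)) := by
    ext y
    simp only [Set.mem_smul, Set.mem_image, Set.mem_preimage]
    constructor
    · rintro ⟨r, hr, _, ⟨x, hx, rfl⟩, rfl⟩
      exact ⟨r, hr, _, ⟨_, hx, rfl⟩, by simp [sphereMap]⟩
    · rintro ⟨r, hr, _, ⟨x, hx, rfl⟩, h⟩
      refine ⟨r, hr, _, ⟨sphereMap R.symm x, ?_, rfl⟩, ?_⟩
      · simpa [sphereMap] using hx
      · apply R.injective
        rw [← h]
        simp [sphereMap]
  rw [hset]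
  exact (R.measurePreserving).measure_preimage_emb R.toHomeomorph.measurableEmbedding _

lemma integral_sphereMap (R : EuclideanSpace ℝ ι ≃ₗᵢ[ℝ] EuclideanSpace ℝ ι)
    {f : EuclideanSpace ℝ ι → ℝ} (hf : Continuous f) :
    ∫ x, f (R x) ∂sphereUniform ι = ∫ x, f x ∂sphereUniform ι := by
  have h := (measurePreserving_sphereMap R).map_eq
  conv_rhs => rw [← h]
  exact (integral_map (continuous_sphereMap R).aemeasurable
    (hf.comp continuous_subtype_val).aestronglyMeasurable).symm

lemma integrable_sphere [Nonempty ι] {f : EuclideanSpace ℝ ι → ℝ} (hf : Continuous f) :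
    Integrable (fun x : Metric.sphere (0 : EuclideanSpace ℝ ι) 1 => f x) (sphereUniform ι) := by
  have hc : Continuous (fun x : Metric.sphere (0 : EuclideanSpace ℝ ι) 1 => f x) :=
    hf.comp continuous_subtype_val
  exact hc.integrable_of_hasCompactSupport (HasCompactSupport.of_compactSpace _)

lemma sum_sq_sphere (x : Metric.sphere (0 : EuclideanSpace ℝ ι) 1) :
    ∑ i, (x : EuclideanSpace ℝ ι) i ^ 2 = 1 := by
  rw [← EuclideanSpace.real_norm_sq_eq]
  simp

variable [DecidableEq ι]

/-- The rotation by the angle `θ` in the plane of the coordinates `i` and `j`. -/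
def planeRotLinear (i j : ι) (θ : ℝ) : EuclideanSpace ℝ ι →ₗ[ℝ] EuclideanSpace ℝ ι where
  toFun x := x + ((cos θ - 1) * x i - sin θ * x j) • EuclideanSpace.single i 1
    + (sin θ * x i + (cos θ - 1) * x j) • EuclideanSpace.single j 1
  map_add' x y := by
    ext k
    simp
    split_ifs <;> ring
  map_smul' c x := by
    ext k
    simp
    split_ifs <;> ring

lemma norm_planeRotLinear {i j : ι} (hij : i ≠ j) (θ : ℝ) (x : EuclideanSpace ℝ ι) :
    ‖planeRotLinear i j θ x‖ = ‖x‖ := by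
  rw [← sq_eq_sq₀ (norm_nonneg _) (norm_nonneg _)]
  simp only [planeRotLinear, LinearMap.coe_mk, AddHom.coe_mk]
  rw [norm_add_sq_real, norm_add_sq_real, inner_add_left]
  simp only [inner_smul_right, inner_smul_left, EuclideanSpace.inner_single_right, norm_smul,
    PiLp.norm_single, norm_one, Real.norm_eq_abs, sq_abs, conj_trivial,
    PiLp.single_apply, hij.symm, if_false, one_mul, mul_zero, add_zero, mul_one]
  have := sin_sq_add_cos_sq θ
  linear_combination (x i ^ 2 + x j ^ 2) * this

/-- The rotation by the angle `θ` in the plane of the coordinates `i ≠ j`, as an isometry. -/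
@[irreducible]
def planeRot {i j : ι} (hij : i ≠ j) (θ : ℝ) :
    EuclideanSpace ℝ ι ≃ₗᵢ[ℝ] EuclideanSpace ℝ ι :=
  LinearIsometry.toLinearIsometryEquiv ⟨planeRotLinear i j θ, norm_planeRotLinear hij θ⟩ rfl

lemma planeRot_apply {i j : ι} (hij : i ≠ j) (θ : ℝ) (x : EuclideanSpace ℝ ι) (k : ι) :
    planeRot hij θ x k = x k + ((cos θ - 1) * x i - sin θ * x j) * (if k = i then 1 else 0)
      + (sin θ * x i + (cos θ - 1) * x j) * (if k = j then 1 else 0) := by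
  simp [planeRot, planeRotLinear]

lemma planeRot_apply_left {i j : ι} (hij : i ≠ j) (θ : ℝ) (x : EuclideanSpace ℝ ι) :
    planeRot hij θ x i = cos θ * x i - sin θ * x j := by
  rw [planeRot_apply]
  simp [hij]
  ring

lemma planeRot_apply_right {i j : ι} (hij : i ≠ j) (θ : ℝ) (x : EuclideanSpace ℝ ι) :
    planeRot hij θ x j = sin θ * x i + cos θ * x j := by
  rw [planeRot_apply]
  simp [hij.symm]
  ring

lemma planeRot_apply_of_ne {i j k : ι} (hij : i ≠ j) (θ : ℝ) (x : EuclideanSpace ℝ ι)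
    (hi : k ≠ i) (hj : k ≠ j) : planeRot hij θ x k = x k := by
  rw [planeRot_apply]
  simp [hi, hj]

lemma Continuous.planeRot {X : Type*} [TopologicalSpace X] {i j : ι} (hij : i ≠ j) {θ : X → ℝ}
    {y : X → EuclideanSpace ℝ ι} (hθ : Continuous θ) (hy : Continuous y) :
    Continuous (fun a => planeRot hij (θ a) (y a)) := by
  have h : (fun a => _root_.planeRot hij (θ a) (y a)) = fun a =>
      y a + ((cos (θ a) - 1) * y a i - sin (θ a) * y a j) • EuclideanSpace.single i (1 : ℝ)
        + (sin (θ a) * y a i + (cos (θ a) - 1) * y a j) • EuclideanSpace.single j (1 : ℝ) := by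
    ext a k
    simp [planeRot_apply]
  rw [h]
  fun_prop

/-- A continuous function that is the derivative of a function along the rotations in a
coordinate plane has mean zero on the sphere. -/
lemma integral_sphere_eq_zero_of_hasDerivAt_planeRot [Nonempty ι] {i j : ι} (hij : i ≠ j)
    {u v : EuclideanSpace ℝ ι → ℝ} (hv : Continuous v)
    (huv : ∀ x θ, HasDerivAt (fun t => u (planeRot hij t x)) (v (planeRot hij θ x)) θ) :
    ∫ x, v x ∂sphereUniform ι = 0 := by
  have hc : Continuous (fun q : Metric.sphere (0 : EuclideanSpace ℝ ι) 1 × ℝ =>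
      v (planeRot hij q.2 q.1)) := by
    exact hv.comp (Continuous.planeRot hij continuous_snd (by fun_prop))
  have hturn : ∀ x : EuclideanSpace ℝ ι, planeRot hij (2 * π) x = planeRot hij 0 x := by
    intro x
    ext k
    simp [planeRot_apply]
  have h0 : ∀ x : EuclideanSpace ℝ ι, ∫ θ in (0 : ℝ)..(2 * π), v (planeRot hij θ x) = 0 := by
    intro x
    rw [intervalIntegral.integral_eq_sub_of_hasDerivAt (fun θ _ => huv x θ), hturn, sub_self]
    refine Continuous.intervalIntegrable ?_ _ _
    exact hv.comp (Continuous.planeRot hij continuous_id continuous_const)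
  have h1 : ∫ θ in (0 : ℝ)..(2 * π), ∫ x, v (planeRot hij θ x) ∂sphereUniform ι = 0 := by
    rw [intervalIntegral.integral_of_le (by positivity), integral_integral_swap]
    · simp_rw [← intervalIntegral.integral_of_le (show (0 : ℝ) ≤ 2 * π by positivity), h0]
      simp
    · have hK : IsCompact (Set.Icc (0 : ℝ) (2 * π) ×ˢ
          (Set.univ : Set (Metric.sphere (0 : EuclideanSpace ℝ ι) 1))) :=
        isCompact_Icc.prod isCompact_univ
      obtain ⟨C, hC⟩ := hK.exists_bound_of_continuousOn (f := fun q => v (planeRot hij q.1 q.2))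
        (hc.comp continuous_swap).continuousOn
      refine Integrable.of_bound (hc.comp continuous_swap).aestronglyMeasurable C ?_
      have hae : ∀ᵐ q ∂((volume.restrict (Set.Ioc (0 : ℝ) (2 * π))).prod (sphereUniform ι)),
          q.1 ∈ Set.Ioc (0 : ℝ) (2 * π) :=
        Measure.quasiMeasurePreserving_fst.ae (ae_restrict_mem measurableSet_Ioc)
      filter_upwards [hae] with q hq
      exact hC q ⟨Set.Ioc_subset_Icc_self hq, Set.mem_univ _⟩
  simp_rw [integral_sphereMap (planeRot hij _) hv] at h1
  simpa [pi_ne_zero] using h1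

end SphereRotation

section SphereMoments

/-- The product `1 · 3 ⋯ (2p - 1)`. -/
def oddProd (p : ℕ) : ℝ := ∏ k ∈ Finset.range p, (2 * (k : ℝ) + 1)

/-- The product `n (n + 2) ⋯ (n + 2p - 2)`. -/
def stepProd (n p : ℕ) : ℝ := ∏ k ∈ Finset.range p, ((n : ℝ) + 2 * k)

lemma oddProd_succ (p : ℕ) : oddProd (p + 1) = oddProd p * (2 * p + 1) :=
  Finset.prod_range_succ _ _

lemma stepProd_succ (n p : ℕ) : stepProd n (p + 1) = stepProd n p * (n + 2 * p) :=
  Finset.prod_range_succ _ _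

lemma oddProd_pos (p : ℕ) : 0 < oddProd p := Finset.prod_pos fun _ _ => by positivity

lemma stepProd_pos {n : ℕ} (hn : 0 < n) (p : ℕ) : 0 < stepProd n p :=
  Finset.prod_pos fun _ _ => by positivity

lemma stepProd_mul_le (n p q : ℕ) : stepProd n p * stepProd n q ≤ stepProd n (p + q) := by
  rw [stepProd, stepProd, stepProd, Finset.prod_range_add]
  gcongr with k hk
  exact Nat.le_add_left _ _

lemma pow_le_stepProd (n p : ℕ) : (n : ℝ) ^ p ≤ stepProd n p := by
  rw [stepProd, ← Finset.card_range p, ← Finset.prod_const, Finset.card_range]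
  gcongr with k hk
  simp

/-- The `r`-th moment of a coordinate of a uniform point of the unit sphere of `ℝⁿ`. -/
def coordMoment (n r : ℕ) : ℝ :=
  if Even r then oddProd (r / 2) / stepProd n (r / 2) else 0

lemma coordMoment_even (n p : ℕ) : coordMoment n (2 * p) = oddProd p / stepProd n p := by
  simp [coordMoment]

lemma coordMoment_odd (n p : ℕ) : coordMoment n (2 * p + 1) = 0 := by
  simp [coordMoment]

lemma pow_mul_coordMoment_le {n : ℕ} (hn : 0 < n) (p : ℕ) :
    (n : ℝ) ^ p * coordMoment n (2 * p) ≤ oddProd p := by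
  rw [coordMoment_even, mul_div_assoc', div_le_iff₀ (stepProd_pos hn p), mul_comm]
  exact mul_le_mul_of_nonneg_left (pow_le_stepProd n p) (oddProd_pos p).le

variable {ι : Type*} [Fintype ι] [DecidableEq ι]

lemma hasDerivAt_planeRot_left {i j : ι} (hij : i ≠ j) (x : EuclideanSpace ℝ ι) (θ : ℝ) :
    HasDerivAt (fun t => planeRot hij t x i) (-(planeRot hij θ x j)) θ := by
  simp only [planeRot_apply_left, planeRot_apply_right]
  refine (((hasDerivAt_cos θ).mul_const (x i)).fun_sub
    ((hasDerivAt_sin θ).mul_const (x j))).congr_deriv ?_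
  ring

lemma hasDerivAt_planeRot_right {i j : ι} (hij : i ≠ j) (x : EuclideanSpace ℝ ι) (θ : ℝ) :
    HasDerivAt (fun t => planeRot hij t x j) (planeRot hij θ x i) θ := by
  simp only [planeRot_apply_left, planeRot_apply_right]
  refine (((hasDerivAt_sin θ).mul_const (x i)).fun_add
    ((hasDerivAt_cos θ).mul_const (x j))).congr_deriv ?_
  ring

lemma integral_sphere_pow_mul_pow_succ [Nonempty ι] {i j : ι} (hij : i ≠ j) (a b : ℕ) :
    (a + 1) * ∫ x, (x : EuclideanSpace ℝ ι) i ^ a * (x : EuclideanSpace ℝ ι) j ^ (b + 2)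
        ∂sphereUniform ι =
      (b + 1) * ∫ x, (x : EuclideanSpace ℝ ι) i ^ (a + 2) * (x : EuclideanSpace ℝ ι) j ^ b
        ∂sphereUniform ι := by
  have h := integral_sphere_eq_zero_of_hasDerivAt_planeRot (ι := ι) hij
    (u := fun x => x i ^ (a + 1) * x j ^ (b + 1))
    (v := fun x => (b + 1) * (x i ^ (a + 2) * x j ^ b) - (a + 1) * (x i ^ a * x j ^ (b + 2)))
    (by fun_prop) (by
      intro x θ
      refine (((hasDerivAt_planeRot_left hij x θ).fun_pow (a + 1)).fun_mul
        ((hasDerivAt_planeRot_right hij x θ).fun_pow (b + 1))).congr_deriv ?_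
      simp
      ring)
  rw [integral_sub, integral_const_mul, integral_const_mul] at h
  · linarith
  · exact integrable_sphere (f := fun x => (b + 1) * (x i ^ (a + 2) * x j ^ b)) (by fun_prop)
  · exact integrable_sphere (f := fun x => (a + 1) * (x i ^ a * x j ^ (b + 2))) (by fun_prop)

lemma integral_sphere_pow_even [Nonempty ι] (i : ι) (p : ℕ) :
    ∫ x, (x : EuclideanSpace ℝ ι) i ^ (2 * p) ∂sphereUniform ι =
      oddProd p / stepProd (Fintype.card ι) p := by
  induction p with
  | zero => simp [oddProd, stepProd]
  | succ p ih =>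
    have h1 : ∫ x, (x : EuclideanSpace ℝ ι) i ^ (2 * p) ∂sphereUniform ι =
        ∑ j, ∫ x, (x : EuclideanSpace ℝ ι) i ^ (2 * p) * (x : EuclideanSpace ℝ ι) j ^ 2
          ∂sphereUniform ι := by
      rw [← integral_finsetSum]
      · simp_rw [← Finset.mul_sum, sum_sq_sphere, mul_one]
      · exact fun j _ => integrable_sphere (f := fun x => x i ^ (2 * p) * x j ^ 2) (by fun_prop)
    have h2 : ∀ j ∈ Finset.univ.erase i,
        ∫ x, (x : EuclideanSpace ℝ ι) i ^ (2 * p) * (x : EuclideanSpace ℝ ι) j ^ 2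
          ∂sphereUniform ι =
        (∫ x, (x : EuclideanSpace ℝ ι) i ^ (2 * (p + 1)) ∂sphereUniform ι) / (2 * p + 1) := by
      intro j hj
      have h := integral_sphere_pow_mul_pow_succ (Finset.ne_of_mem_erase hj).symm (2 * p) 0
      rw [eq_div_iff (by positivity), mul_comm]
      simpa [mul_add] using h
    have hcard : 0 < Fintype.card ι := Fintype.card_pos
    rw [← Finset.add_sum_erase _ _ (Finset.mem_univ i), Finset.sum_congr rfl h2,
      Finset.sum_const, Finset.card_erase_of_mem (Finset.mem_univ i), Finset.card_univ,
      nsmul_eq_mul, Nat.cast_pred hcard, ih] at h1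
    simp_rw [← pow_add] at h1
    rw [show 2 * p + 2 = 2 * (p + 1) by ring] at h1
    have := stepProd_pos hcard p
    rw [oddProd_succ, stepProd_succ]
    field_simp at h1 ⊢
    linarith

lemma integral_sphere_pow_even_mul_pow_even [Nonempty ι] {i j : ι} (hij : i ≠ j) (p q : ℕ) :
    ∫ x, (x : EuclideanSpace ℝ ι) i ^ (2 * p) * (x : EuclideanSpace ℝ ι) j ^ (2 * q)
      ∂sphereUniform ι = oddProd p * oddProd q / stepProd (Fintype.card ι) (p + q) := by
  induction q generalizing p with
  | zero => simpa [oddProd] using integral_sphere_pow_even i p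
  | succ q ih =>
    have h := integral_sphere_pow_mul_pow_succ hij (2 * p) (2 * q)
    rw [show 2 * p + 2 = 2 * (p + 1) by ring, ih, show 2 * q + 2 = 2 * (q + 1) by ring,
      oddProd_succ] at h
    rw [oddProd_succ, ← add_assoc, add_right_comm]
    push_cast at h
    rw [← mul_right_inj' (show (2 * (p : ℝ) + 1) ≠ 0 by positivity), h]
    ring

lemma integral_sphere_odd {i j : ι} (hij : i ≠ j) {F : ℝ → ℝ} (hF : Continuous F)
    (hodd : ∀ t, F (-t) = -F t) :
    ∫ x, F ((x : EuclideanSpace ℝ ι) i) ∂sphereUniform ι = 0 := by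
  have h := integral_sphereMap (planeRot hij π)
    (f := fun x : EuclideanSpace ℝ ι => F (x i)) (by fun_prop)
  simp only [planeRot_apply_left, cos_pi, sin_pi, neg_one_mul, zero_mul, sub_zero, hodd,
    integral_neg] at h
  linarith

lemma integral_sphere_odd_mul_odd {i j : ι} (hij : i ≠ j) {F : ℝ → ℝ} (hF : Continuous F)
    (hodd : ∀ t, F (-t) = -F t) :
    ∫ x, F ((x : EuclideanSpace ℝ ι) i) * F ((x : EuclideanSpace ℝ ι) j) ∂sphereUniform ι = 0 := by
  have h := integral_sphereMap (planeRot hij (π / 2))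
    (f := fun x : EuclideanSpace ℝ ι => F (x i) * F (x j)) (by fun_prop)
  simp only [planeRot_apply_left, planeRot_apply_right, cos_pi_div_two, sin_pi_div_two, one_mul,
    zero_mul, zero_sub, add_zero, hodd, neg_mul, integral_neg] at h
  simp_rw [mul_comm (F ((_ : EuclideanSpace ℝ ι) j))] at h
  linarith

/-- The expectation of a polynomial in a coordinate of a uniform point of the unit sphere
of `ℝⁿ`. -/
def coordMean (n : ℕ) : Polynomial ℝ →ₗ[ℝ] ℝ :=
  Polynomial.lsum fun r => coordMoment n r • LinearMap.id

lemma coordMean_monomial (n r : ℕ) (c : ℝ) :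
    coordMean n (Polynomial.monomial r c) = coordMoment n r * c := by
  simp [coordMean, Polynomial.sum_monomial_index]

lemma integral_sphere_eval [Nontrivial ι] (i : ι) (P : Polynomial ℝ) :
    ∫ x, P.eval ((x : EuclideanSpace ℝ ι) i) ∂sphereUniform ι =
      coordMean (Fintype.card ι) P := by
  obtain ⟨j, hj⟩ := exists_ne i
  induction P using Polynomial.induction_on' with
  | add P Q hP hQ =>
    rw [map_add, ← hP, ← hQ, ← integral_add]
    · simp
    · exact integrable_sphere (f := fun x => P.eval (x i)) (by fun_prop)
    · exact integrable_sphere (f := fun x => Q.eval (x i)) (by fun_prop)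
  | monomial r c =>
    simp_rw [coordMean_monomial, Polynomial.eval_monomial, integral_const_mul]
    rw [mul_comm]
    congr 1
    rcases Nat.even_or_odd' r with ⟨p, rfl | rfl⟩
    · rw [coordMoment_even, integral_sphere_pow_even]
    · rw [coordMoment_odd]
      exact integral_sphere_odd hj.symm (F := fun t => t ^ (2 * p + 1)) (by fun_prop)
        fun t => Odd.neg_pow ⟨p, rfl⟩ t

end SphereMoments

section SteinKernel

variable {ι : Type*} [Fintype ι] [DecidableEq ι]

lemma hasDerivAt_planeRot_apply {i j : ι} (hij : i ≠ j) (x : EuclideanSpace ℝ ι) (θ : ℝ)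
    (m : ι) : HasDerivAt (fun t => planeRot hij t x m)
      (-(planeRot hij θ x j) * (if m = i then 1 else 0)
        + planeRot hij θ x i * (if m = j then 1 else 0)) θ := by
  by_cases hi : m = i
  · subst hi
    simpa [hij] using hasDerivAt_planeRot_left hij x θ
  by_cases hj : m = j
  · subst hj
    simpa [hi] using hasDerivAt_planeRot_right hij x θ
  · simp only [planeRot_apply_of_ne hij _ x hi hj]
    simpa [hi, hj] using hasDerivAt_const θ (x m)

lemma hasDerivAt_sum_eval_planeRot {i j : ι} (hij : i ≠ j) (a : ι → ℝ) (φ : Polynomial ℝ)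
    (x : EuclideanSpace ℝ ι) (θ : ℝ) :
    HasDerivAt (fun t => ∑ m, a m * φ.eval (planeRot hij t x m))
      (a j * φ.derivative.eval (planeRot hij θ x j) * planeRot hij θ x i
        - a i * φ.derivative.eval (planeRot hij θ x i) * planeRot hij θ x j) θ := by
  have h := HasDerivAt.fun_sum (u := Finset.univ) fun m _ =>
    ((φ.hasDerivAt _).comp θ (hasDerivAt_planeRot_apply hij x θ m)).const_mul (a m)
  refine h.congr_deriv ?_
  simp only [mul_add, Finset.sum_add_distrib]
  simp
  ring

lemma integral_eval_mul_comp_sum [Nonempty ι] (a : ι → ℝ) (φ : Polynomial ℝ) {μ : ℝ}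
    (hφ : ∀ t, (1 - t ^ 2) * φ.derivative.derivative.eval t
      - (Fintype.card ι - 1) * t * φ.derivative.eval t = -μ * φ.eval t)
    {g g' : ℝ → ℝ} (hg : ∀ w, HasDerivAt g (g' w) w) (hg' : Continuous g') (k : ι) :
    ∫ x : Metric.sphere (0 : EuclideanSpace ℝ ι) 1,
      (μ * φ.eval ((x : EuclideanSpace ℝ ι) k) *
          g (∑ m, a m * φ.eval ((x : EuclideanSpace ℝ ι) m))
        - g' (∑ m, a m * φ.eval ((x : EuclideanSpace ℝ ι) m)) *
          (a k * φ.derivative.eval ((x : EuclideanSpace ℝ ι) k) ^ 2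
            - (x : EuclideanSpace ℝ ι) k * φ.derivative.eval ((x : EuclideanSpace ℝ ι) k) *
              ∑ m, a m * ((x : EuclideanSpace ℝ ι) m *
                φ.derivative.eval ((x : EuclideanSpace ℝ ι) m))))
      ∂sphereUniform ι = 0 := by
  have hgc : Continuous g := continuous_iff_continuousAt.2 fun w => (hg w).continuousAt
  set W : EuclideanSpace ℝ ι → ℝ := fun x => ∑ m, a m * φ.eval (x m) with hW
  have hWc : Continuous W := by fun_prop
  set v : ι → EuclideanSpace ℝ ι → ℝ := fun j x =>
    (x k * φ.derivative.eval (x k) - x j ^ 2 * φ.derivative.derivative.eval (x k)) * g (W x)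
      + x j * φ.derivative.eval (x k) * (g' (W x) *
        (a j * φ.derivative.eval (x j) * x k - a k * φ.derivative.eval (x k) * x j)) with hv
  have hvc : ∀ j, Continuous (v j) := fun j => by fun_prop
  have h0 : ∀ j ∈ Finset.univ.erase k, ∫ x, v j x ∂sphereUniform ι = 0 := by
    intro j hj
    have hkj : k ≠ j := (Finset.ne_of_mem_erase hj).symm
    refine integral_sphere_eq_zero_of_hasDerivAt_planeRot hkj
      (u := fun x => x j * φ.derivative.eval (x k) * g (W x)) (hvc j) fun x θ => ?_
    refine (((hasDerivAt_planeRot_right hkj x θ).fun_mul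
      ((φ.derivative.hasDerivAt _).comp θ (hasDerivAt_planeRot_left hkj x θ))).fun_mul
      ((hg _).comp θ (hasDerivAt_sum_eval_planeRot hkj a φ x θ))).congr_deriv ?_
    simp only [hv, hW, Function.comp_apply]
    ring
  rw [← Finset.sum_eq_zero h0, ← integral_finsetSum]
  · refine integral_congr_ae (Filter.Eventually.of_forall fun x => ?_)
    have hx := sum_sq_sphere x
    have h1 := Finset.add_sum_erase Finset.univ (fun j => v j x) (Finset.mem_univ k)
    have h2 : ∑ j, v j x = (Fintype.card ι * ((x : EuclideanSpace ℝ ι) k *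
        φ.derivative.eval ((x : EuclideanSpace ℝ ι) k))
        - (∑ j, (x : EuclideanSpace ℝ ι) j ^ 2) *
          φ.derivative.derivative.eval ((x : EuclideanSpace ℝ ι) k)) * g (W x)
        + g' (W x) * (φ.derivative.eval ((x : EuclideanSpace ℝ ι) k) *
          ((x : EuclideanSpace ℝ ι) k * (∑ m, a m * ((x : EuclideanSpace ℝ ι) m *
            φ.derivative.eval ((x : EuclideanSpace ℝ ι) m)))
          - a k * φ.derivative.eval ((x : EuclideanSpace ℝ ι) k) *
            ∑ j, (x : EuclideanSpace ℝ ι) j ^ 2)) := by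
      simp only [hv, Finset.sum_add_distrib, ← Finset.sum_mul, Finset.sum_sub_distrib,
        Finset.sum_const, Finset.card_univ, nsmul_eq_mul]
      congr 1
      · ring
      rw [Finset.mul_sum, Finset.mul_sum, ← Finset.sum_sub_distrib, Finset.mul_sum,
        Finset.mul_sum]
      exact Finset.sum_congr rfl fun j _ => by ring
    rw [hx] at h2
    have h3 : v k x = ((x : EuclideanSpace ℝ ι) k * φ.derivative.eval ((x : EuclideanSpace ℝ ι) k)
        - (x : EuclideanSpace ℝ ι) k ^ 2 *
          φ.derivative.derivative.eval ((x : EuclideanSpace ℝ ι) k)) * g (W x) := by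
      simp only [hv]
      ring
    have h4 := hφ ((x : EuclideanSpace ℝ ι) k)
    simp only
    linear_combination (-1) * h1 - h2 + h3 + g (W x) * h4
  · exact fun j _ => integrable_sphere (hvc j)

/-- Integration by parts against a sum of spherical eigenfunctions of the coordinates. -/
lemma integral_sum_mul_comp_sum [Nonempty ι] (a : ι → ℝ) (φ : Polynomial ℝ) {μ : ℝ}
    (hφ : ∀ t, (1 - t ^ 2) * φ.derivative.derivative.eval t
      - (Fintype.card ι - 1) * t * φ.derivative.eval t = -μ * φ.eval t)
    {g g' : ℝ → ℝ} (hg : ∀ w, HasDerivAt g (g' w) w) (hg' : Continuous g') :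
    ∫ x : Metric.sphere (0 : EuclideanSpace ℝ ι) 1,
      (μ * ((∑ m, a m * φ.eval ((x : EuclideanSpace ℝ ι) m)) *
          g (∑ m, a m * φ.eval ((x : EuclideanSpace ℝ ι) m)))
        - g' (∑ m, a m * φ.eval ((x : EuclideanSpace ℝ ι) m)) *
          ((∑ m, a m ^ 2 * φ.derivative.eval ((x : EuclideanSpace ℝ ι) m) ^ 2)
            - (∑ m, a m * ((x : EuclideanSpace ℝ ι) m *
                φ.derivative.eval ((x : EuclideanSpace ℝ ι) m))) ^ 2))
      ∂sphereUniform ι = 0 := by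
  have hgc : Continuous g := continuous_iff_continuousAt.2 fun w => (hg w).continuousAt
  have h := fun k => congrArg (a k * ·) (integral_eval_mul_comp_sum a φ hφ hg hg' k)
  simp only [mul_zero, ← integral_const_mul] at h
  rw [← Finset.sum_eq_zero fun k (_ : k ∈ Finset.univ) => h k, ← integral_finsetSum]
  · refine integral_congr_ae (Filter.Eventually.of_forall fun x => ?_)
    simp only [mul_sub, Finset.sum_sub_distrib]
    congr 1
    · rw [Finset.sum_mul, Finset.mul_sum]
      exact Finset.sum_congr rfl fun j _ => by ring
    · congr 1
      · rw [Finset.mul_sum]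
        exact Finset.sum_congr rfl fun j _ => by ring
      · rw [pow_two, Finset.sum_mul, Finset.mul_sum]
        exact Finset.sum_congr rfl fun j _ => by ring
  · intro k _
    exact integrable_sphere (f := fun x => a k * (μ * φ.eval (x k) *
          g (∑ m, a m * φ.eval (x m)) - g' (∑ m, a m * φ.eval (x m)) *
          (a k * φ.derivative.eval (x k) ^ 2 - x k * φ.derivative.eval (x k) *
              ∑ m, a m * (x m * φ.derivative.eval (x m))))) (by fun_prop)

end SteinKernel

section Gegenbauer

open Polynomial in
lemma coordMean_ibp {n : ℕ} (hn : 0 < n) (u : Polynomial ℝ) :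
    coordMean n ((1 - X ^ 2) * derivative u - C ((n : ℝ) - 1) * X * u) = 0 := by
  induction u using Polynomial.induction_on' with
  | add P Q hP hQ =>
    have h : (1 - X ^ 2) * derivative (P + Q) - C ((n : ℝ) - 1) * X * (P + Q) =
        ((1 - X ^ 2) * derivative P - C ((n : ℝ) - 1) * X * P)
          + ((1 - X ^ 2) * derivative Q - C ((n : ℝ) - 1) * X * Q) := by
      rw [derivative_add]
      ring
    rw [h, map_add, hP, hQ, add_zero]
  | monomial r c =>
    have h1 : C ((n : ℝ) - 1) * X * monomial r c = monomial (r + 1) (((n : ℝ) - 1) * c) := by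
      rw [mul_assoc, X_mul_monomial, C_mul_monomial]
    rcases r with _ | r
    · rw [h1]
      simp [coordMean_monomial, coordMoment]
    · have h2 : (1 - X ^ 2) * derivative (monomial (r + 1) c) =
          monomial r (c * (r + 1)) - monomial (r + 2) (c * (r + 1)) := by
        rw [derivative_monomial, sub_mul, one_mul, X_pow_mul_monomial]
        simp
      rw [h1, h2, map_sub, map_sub, coordMean_monomial, coordMean_monomial, coordMean_monomial]
      rcases Nat.even_or_odd' r with ⟨p, rfl | rfl⟩
      · rw [show 2 * p + 1 + 1 = 2 * (p + 1) by ring,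
          coordMoment_even, coordMoment_even, oddProd_succ, stepProd_succ]
        have := stepProd_pos hn p
        push_cast
        field_simp
        ring
      · rw [show 2 * p + 1 + 1 + 1 = 2 * (p + 1) + 1 by ring, coordMoment_odd, coordMoment_odd]
        ring

lemma stepProd_add_two {n : ℕ} (hn : 0 < n) (p : ℕ) :
    stepProd (n + 2) p = stepProd n p * (n + 2 * p) / n := by
  induction p with
  | zero =>
    simp only [stepProd, Finset.range_zero, Finset.prod_empty]
    field_simp
    simp
  | succ p ih =>
    rw [stepProd_succ, ih, stepProd_succ]
    push_cast
    ring

open Polynomial in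
lemma coordMean_one_sub_sq_mul {n : ℕ} (hn : 0 < n) (v : Polynomial ℝ) :
    coordMean n ((1 - X ^ 2) * v) = ((n : ℝ) - 1) / n * coordMean (n + 2) v := by
  induction v using Polynomial.induction_on' with
  | add P Q hP hQ => rw [mul_add, map_add, map_add, hP, hQ, mul_add]
  | monomial r c =>
    rw [sub_mul, one_mul, X_pow_mul_monomial, map_sub, coordMean_monomial, coordMean_monomial,
      coordMean_monomial]
    rcases Nat.even_or_odd' r with ⟨p, rfl | rfl⟩
    · rw [show 2 * p + 2 = 2 * (p + 1) by ring, coordMoment_even, coordMoment_even,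
        coordMoment_even, oddProd_succ, stepProd_succ, stepProd_add_two hn]
      have := stepProd_pos hn p
      field_simp
      ring
    · rw [show 2 * p + 1 + 2 = 2 * (p + 1) + 1 by ring, coordMoment_odd, coordMoment_odd,
        coordMoment_odd]
      ring

open Polynomial in
lemma coordMean_sq_of_ode {n : ℕ} (hn : 0 < n) {φ : Polynomial ℝ} {μ : ℝ}
    (hφ : (1 - X ^ 2) * derivative (derivative φ) - C ((n : ℝ) - 1) * X * derivative φ
      = -C μ * φ) :
    μ * coordMean n (φ ^ 2) = coordMean n ((1 - X ^ 2) * derivative φ ^ 2) := by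
  have h := coordMean_ibp hn (φ * derivative φ)
  have h1 : (1 - X ^ 2) * derivative (φ * derivative φ) - C ((n : ℝ) - 1) * X * (φ * derivative φ)
      = (1 - X ^ 2) * derivative φ ^ 2 - μ • φ ^ 2 := by
    rw [derivative_mul, smul_eq_C_mul]
    linear_combination φ * hφ
  rw [h1, map_sub, map_smul, smul_eq_mul] at h
  linarith

/-- The rising factorial `k (k + 1) ⋯ (k + r - 1)`. -/
def risingProd (k : ℝ) (r : ℕ) : ℝ := ∏ i ∈ Finset.range r, (k + i)

lemma Gamma_add_natCast {k : ℝ} (hk : 0 < k) (r : ℕ) :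
    Gamma (k + r) = risingProd k r * Gamma k := by
  induction r with
  | zero => simp [risingProd]
  | succ r ih =>
    rw [Nat.cast_succ, ← add_assoc, Gamma_add_one (by positivity), ih, risingProd, risingProd,
      Finset.prod_range_succ]
    ring

lemma risingProd_succ (k : ℝ) (r : ℕ) : risingProd k (r + 1) = risingProd k r * (k + r) :=
  Finset.prod_range_succ _ _

lemma risingProd_succ' (k : ℝ) (r : ℕ) : risingProd k (r + 1) = k * risingProd (k + 1) r := by
  rw [risingProd, Finset.prod_range_succ', risingProd, mul_comm]
  congr 1
  · simp
  · exact Finset.prod_congr rfl fun i _ => by push_cast; ring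

/-- The coefficient of `t ^ (m - 2j)` in the Gegenbauer polynomial `C^k_m(t)`. -/
def gegenbauerCoeff (k : ℝ) (m j : ℕ) : ℝ :=
  (-1) ^ j * 2 ^ (m - 2 * j) * risingProd k (m - j) / (j.factorial * (m - 2 * j).factorial)

/-- The Gegenbauer polynomial `C^k_m` as a polynomial. -/
def gegenbauerPoly (k : ℝ) (m : ℕ) : Polynomial ℝ :=
  ∑ j ∈ Finset.range (m / 2 + 1), Polynomial.monomial (m - 2 * j) (gegenbauerCoeff k m j)

lemma eval_gegenbauerPoly {k : ℝ} (hk : 0 < k) (m : ℕ) (t : ℝ) :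
    (gegenbauerPoly k m).eval t = gegenbauer k m t := by
  rw [gegenbauerPoly, gegenbauer, Polynomial.eval_finsetSum, Finset.mul_sum]
  refine Finset.sum_congr rfl fun j hj => ?_
  have hj' : 2 * j ≤ m := by
    have := Finset.mem_range.1 hj
    omega
  have hG := (Gamma_pos_of_pos hk).ne'
  have hc : (m : ℝ) - j = ((m - j : ℕ) : ℝ) := by
    rw [Nat.cast_sub (by omega)]
  have h2 : (2 : ℝ) ^ m = 2 ^ (m - 2 * j) * 2 ^ (2 * j) := by
    rw [← pow_add, Nat.sub_add_cancel hj']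
  rw [Polynomial.eval_monomial, gegenbauerCoeff, add_sub_assoc, hc, Gamma_add_natCast hk, h2]
  field_simp

lemma derivative_gegenbauerPoly (k : ℝ) (m : ℕ) :
    Polynomial.derivative (gegenbauerPoly k (m + 1)) =
      Polynomial.C (2 * k) * gegenbauerPoly (k + 1) m := by
  have hterm : ∀ j ∈ Finset.range (m / 2 + 1),
      Polynomial.derivative (Polynomial.monomial (m + 1 - 2 * j) (gegenbauerCoeff k (m + 1) j)) =
        Polynomial.C (2 * k) * Polynomial.monomial (m - 2 * j) (gegenbauerCoeff (k + 1) m j) := by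
    intro j hj
    have hj' : 2 * j ≤ m := by
      have := Finset.mem_range.1 hj
      omega
    rw [Polynomial.derivative_monomial, Polynomial.C_mul_monomial, gegenbauerCoeff,
      gegenbauerCoeff, show m + 1 - 2 * j = m - 2 * j + 1 by omega,
      show m + 1 - j = m - j + 1 by omega, risingProd_succ', Nat.factorial_succ,
      Nat.add_sub_cancel]
    congr 1
    push_cast
    field_simp
    ring
  rw [gegenbauerPoly, gegenbauerPoly, Finset.mul_sum, ← Finset.sum_congr rfl hterm]
  rw [Polynomial.derivative_sum]
  rcases Nat.even_or_odd' m with ⟨q, rfl | rfl⟩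
  · rw [show (2 * q + 1) / 2 = 2 * q / 2 by omega]
  · rw [show (2 * q + 1 + 1) / 2 + 1 = (2 * q + 1) / 2 + 1 + 1 by omega, Finset.sum_range_succ,
      show 2 * q + 1 + 1 - 2 * ((2 * q + 1) / 2 + 1) = 0 by omega]
    simp

open Polynomial in
lemma gegenbauerPoly_ode (k : ℝ) (m : ℕ) :
    (1 - X ^ 2) * derivative (derivative (gegenbauerPoly k m))
      - C (2 * k + 1) * X * derivative (gegenbauerPoly k m)
      = -C ((m : ℝ) * (m + 2 * k)) * gegenbauerPoly k m := by
  set u : ℕ → Polynomial ℝ := fun j => if 2 * j ≤ m then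
    monomial (m - 2 * j) (4 * j * (m - j + k) * gegenbauerCoeff k m j) else 0 with hu
  have hterm : ∀ j ∈ Finset.range (m / 2 + 1),
      (1 - X ^ 2) * derivative (derivative (monomial (m - 2 * j) (gegenbauerCoeff k m j)))
        - C (2 * k + 1) * X * derivative (monomial (m - 2 * j) (gegenbauerCoeff k m j))
        + C ((m : ℝ) * (m + 2 * k)) * monomial (m - 2 * j) (gegenbauerCoeff k m j)
        = u j - u (j + 1) := by
    intro j hj
    obtain ⟨r, rfl⟩ : ∃ r, m = 2 * j + r := ⟨m - 2 * j, by
      have := Finset.mem_range.1 hj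
      omega⟩
    simp only [hu, le_add_iff_nonneg_right, zero_le, if_true, Nat.add_sub_cancel_left]
    rcases r with _ | _ | s
    · have hd (c : ℝ) : derivative (monomial 0 c) = 0 := by simp
      rw [if_neg (by omega), hd, derivative_zero, mul_zero, mul_zero, sub_zero, zero_add,
        sub_zero, C_mul_monomial]
      congr 1
      push_cast
      ring
    · have hd (c : ℝ) : derivative (monomial (0 + 1) c) = monomial 0 c := by simp
      have hdd (c : ℝ) : derivative (monomial 0 c) = 0 := by simp
      rw [if_neg (by omega), hd, hdd, mul_zero, zero_sub, sub_zero, mul_assoc, X_mul_monomial,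
        C_mul_monomial, C_mul_monomial, ← map_neg, ← map_add]
      congr 1
      push_cast
      ring
    · rw [if_pos (by omega)]
      have h1 : gegenbauerCoeff k (2 * j + (s + 1 + 1)) (j + 1) * (4 * (j + 1) * (j + s + 1 + k)) =
          -(gegenbauerCoeff k (2 * j + (s + 1 + 1)) j * ((s + 1 + 1) * (s + 1))) := by
        rw [gegenbauerCoeff, gegenbauerCoeff,
          show 2 * j + (s + 1 + 1) - (j + 1) = j + s + 1 by omega,
          show 2 * j + (s + 1 + 1) - j = j + s + 1 + 1 by omega,
          show 2 * j + (s + 1 + 1) - 2 * (j + 1) = s by omega,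
          show 2 * j + (s + 1 + 1) - 2 * j = s + 1 + 1 by omega,
          risingProd_succ k (j + s + 1), Nat.factorial_succ j, Nat.factorial_succ (s + 1),
          Nat.factorial_succ s]
        have := s.factorial_pos
        have := j.factorial_pos
        push_cast
        field_simp
        ring
      rw [show 2 * j + (s + 1 + 1) - 2 * (j + 1) = s by omega]
      set c := gegenbauerCoeff k (2 * j + (s + 1 + 1)) j
      set c' := gegenbauerCoeff k (2 * j + (s + 1 + 1)) (j + 1)
      have hd : derivative (monomial (s + 1 + 1) c) = monomial (s + 1) (c * (s + 1 + 1)) := by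
        simp
      have hdd : derivative (monomial (s + 1) (c * ((s : ℝ) + 1 + 1))) =
          monomial s (c * (s + 1 + 1) * (s + 1)) := by
        simp
      rw [hd, hdd, sub_mul, one_mul, X_pow_mul_monomial, mul_assoc (C _) X, X_mul_monomial,
        C_mul_monomial, C_mul_monomial]
      have h2 : 4 * ((j + 1 : ℕ) : ℝ) * (((2 * j + (s + 1 + 1) : ℕ) : ℝ) - ((j + 1 : ℕ) : ℝ) + k)
          * c' = -(c * (s + 1 + 1) * (s + 1)) := by
        push_cast
        linear_combination h1
      have h3 : 4 * (j : ℝ) * (((2 * j + (s + 1 + 1) : ℕ) : ℝ) - j + k) * c =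
          -(c * (s + 1 + 1) * (s + 1)) - (2 * k + 1) * (c * (s + 1 + 1))
            + ((2 * j + (s + 1 + 1) : ℕ) : ℝ) * (((2 * j + (s + 1 + 1) : ℕ) : ℝ) + 2 * k) * c := by
        push_cast
        ring
      rw [h2, h3, map_add, map_sub, map_neg, map_neg]
      ring
  have hsum := Finset.sum_congr rfl hterm
  rw [Finset.sum_range_sub', Finset.sum_add_distrib, Finset.sum_sub_distrib, ← Finset.mul_sum,
    ← Finset.mul_sum, ← Finset.mul_sum, ← derivative_sum, ← derivative_sum] at hsum
  have hu0 : u 0 = 0 := by simp [hu]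
  have hu1 : u (m / 2 + 1) = 0 := if_neg (by omega)
  rw [hu0, hu1] at hsum
  rw [gegenbauerPoly]
  linear_combination hsum

lemma coordMean_gegenbauerPoly_sq (N m : ℕ) :
    coordMean (N + 3) (gegenbauerPoly (((N : ℝ) + 1) / 2) m ^ 2) =
      (N + 1) * (N + m).factorial / ((N + 1 + 2 * m) * m.factorial * N.factorial) := by
  induction m generalizing N with
  | zero =>
    have h1 : gegenbauerPoly (((N : ℝ) + 1) / 2) 0 ^ 2 = Polynomial.monomial 0 1 := by
      simp [gegenbauerPoly, gegenbauerCoeff, risingProd]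
    rw [h1, coordMean_monomial]
    have := N.factorial_pos
    simp [coordMoment, oddProd, stepProd]
    field_simp
  | succ m ih =>
    have hode := gegenbauerPoly_ode (((N : ℝ) + 1) / 2) (m + 1)
    have h := coordMean_sq_of_ode (n := N + 3) (by omega)
      (φ := gegenbauerPoly (((N : ℝ) + 1) / 2) (m + 1))
      (μ := ((m + 1 : ℕ) : ℝ) * ((m + 1 : ℕ) + 2 * (((N : ℝ) + 1) / 2))) (by
        rw [← hode]
        congr 4
        push_cast
        ring)
    rw [coordMean_one_sub_sq_mul (by omega), derivative_gegenbauerPoly, mul_pow, ← map_pow,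
      ← Polynomial.smul_eq_C_mul, map_smul, smul_eq_mul] at h
    have h' := ih (N + 2)
    rw [show ((N + 2 : ℕ) : ℝ) + 1 = N + 1 + 2 by push_cast; ring, add_div,
      div_self (two_ne_zero), show N + 2 + 3 = N + 3 + 2 by ring] at h'
    rw [h'] at h
    have hμ : ((m + 1 : ℕ) : ℝ) * ((m + 1 : ℕ) + 2 * (((N : ℝ) + 1) / 2)) ≠ 0 := by positivity
    rw [← mul_right_inj' hμ, h, show N + 2 + m = N + (m + 1) + 1 by ring, Nat.factorial_succ,
      Nat.factorial_succ m, show N + 2 = N + 1 + 1 by ring, Nat.factorial_succ (N + 1),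
      Nat.factorial_succ N]
    have := N.factorial_pos
    have := m.factorial_pos
    push_cast
    field_simp
    ring

end Gegenbauer

section SteinEquation

/-- The density of the standard Gaussian distribution. -/
def stdPDF (x : ℝ) : ℝ := gaussianPDFReal 0 1 x

lemma stdPDF_eq (x : ℝ) : stdPDF x = (√(2 * π))⁻¹ * exp (-x ^ 2 / 2) := by
  simp [stdPDF, gaussianPDFReal]

lemma stdPDF_pos (x : ℝ) : 0 < stdPDF x := gaussianPDFReal_pos _ _ _ one_ne_zero

lemma stdPDF_neg (x : ℝ) : stdPDF (-x) = stdPDF x := by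
  simp [stdPDF_eq]

lemma integrable_stdPDF : Integrable stdPDF := integrable_gaussianPDFReal 0 1

lemma hasDerivAt_stdPDF (x : ℝ) : HasDerivAt stdPDF (-x * stdPDF x) x := by
  have h : HasDerivAt (fun x : ℝ => (√(2 * π))⁻¹ * exp (-x ^ 2 / 2))
      ((√(2 * π))⁻¹ * (exp (-x ^ 2 / 2) * (-(2 * x) / 2))) x := by
    have := (((hasDerivAt_pow 2 x).fun_neg.div_const 2).exp).const_mul (√(2 * π))⁻¹
    simpa using this
  rw [show stdPDF = fun x : ℝ => (√(2 * π))⁻¹ * exp (-x ^ 2 / 2) from funext stdPDF_eq]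
  refine h.congr_deriv ?_
  ring

lemma continuous_stdPDF : Continuous stdPDF :=
  continuous_iff_continuousAt.2 fun x => (hasDerivAt_stdPDF x).continuousAt

lemma tendsto_stdPDF_atTop : Filter.Tendsto stdPDF Filter.atTop (nhds 0) := by
  rw [show stdPDF = fun x : ℝ => (√(2 * π))⁻¹ * exp (-x ^ 2 / 2) from funext stdPDF_eq]
  rw [← mul_zero (√(2 * π))⁻¹]
  refine (tendsto_exp_atBot.comp ?_).const_mul _
  have h : Filter.Tendsto (fun x : ℝ => x ^ 2 / 2) Filter.atTop Filter.atTop :=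
    (Filter.tendsto_pow_atTop two_ne_zero).atTop_div_const two_pos
  refine (Filter.tendsto_neg_atTop_atBot.comp h).congr fun x => ?_
  simp [neg_div]

lemma mul_integral_Ioi_stdPDF_le {w : ℝ} (hw : 0 ≤ w) :
    w * ∫ t in Set.Ioi w, stdPDF t ≤ stdPDF w := by
  have hd : ∀ x ∈ Set.Ici w, HasDerivAt (fun t => -stdPDF t) (x * stdPDF x) x := fun x _ =>
    (hasDerivAt_stdPDF x).fun_neg.congr_deriv (by ring)
  have hpos : ∀ x ∈ Set.Ioi w, 0 ≤ x * stdPDF x := fun x hx =>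
    mul_nonneg (hw.trans (le_of_lt hx)) (stdPDF_pos x).le
  have ht : Filter.Tendsto (fun t => -stdPDF t) Filter.atTop (nhds 0) := by
    simpa using tendsto_stdPDF_atTop.neg
  have h1 := integral_Ioi_of_hasDerivAt_of_nonneg' hd hpos ht
  have h2 := integrableOn_Ioi_deriv_of_nonneg' hd hpos ht
  rw [← integral_const_mul]
  calc ∫ t in Set.Ioi w, w * stdPDF t ≤ ∫ t in Set.Ioi w, t * stdPDF t := by
        refine setIntegral_mono_on (integrable_stdPDF.const_mul w).integrableOn h2
          measurableSet_Ioi fun t ht => ?_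
        exact mul_le_mul_of_nonneg_right (le_of_lt ht) (stdPDF_pos t).le
    _ = stdPDF w := by rw [h1]; ring

lemma abs_setIntegral_mul_stdPDF_le {k : ℝ → ℝ} (hk : ∀ t, |k t| ≤ 1) (s : Set ℝ) :
    |∫ t in s, k t * stdPDF t| ≤ ∫ t in s, stdPDF t := by
  rw [← Real.norm_eq_abs]
  refine norm_integral_le_of_norm_le integrable_stdPDF.integrableOn ?_
  refine Filter.Eventually.of_forall fun t => ?_
  rw [norm_mul, Real.norm_eq_abs, Real.norm_eq_abs, abs_of_pos (stdPDF_pos t)]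
  exact mul_le_of_le_one_left (stdPDF_pos t).le (hk t)

/-- Solutions of Stein's equation for a centered continuous function bounded by one have
derivative bounded by two. -/
lemma exists_stein_solution {k : ℝ → ℝ} (hkc : Continuous k) (hk : ∀ t, |k t| ≤ 1)
    (hk0 : ∫ t, k t ∂gaussianReal 0 1 = 0) :
    ∃ g g' : ℝ → ℝ, (∀ w, HasDerivAt g (g' w) w) ∧ Continuous g' ∧
      (∀ w, g' w - w * g w = k w) ∧ ∀ w, |g' w| ≤ 2 := by
  have hint : Integrable (fun t => k t * stdPDF t) := by
    refine Integrable.mono' integrable_stdPDF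
      (hkc.mul continuous_stdPDF).aestronglyMeasurable (Filter.Eventually.of_forall fun t => ?_)
    rw [norm_mul, Real.norm_eq_abs, Real.norm_eq_abs, abs_of_pos (stdPDF_pos t)]
    exact mul_le_of_le_one_left (stdPDF_pos t).le (hk t)
  have htot : ∫ t, k t * stdPDF t = 0 := by
    rw [integral_gaussianReal_eq_integral_smul one_ne_zero] at hk0
    simpa [mul_comm, stdPDF] using hk0
  set K : ℝ → ℝ := fun w => ∫ t in Set.Iic w, k t * stdPDF t with hK
  have hKd : ∀ w, HasDerivAt K (k w * stdPDF w) w := by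
    intro w
    have h := (show Continuous fun t => k t * stdPDF t from
      hkc.mul continuous_stdPDF).integral_hasStrictDerivAt 0 w
    refine (h.hasDerivAt.const_add (K 0)).congr_of_eventuallyEq
      (Filter.Eventually.of_forall fun y => ?_)
    have := intervalIntegral.integral_Iic_sub_Iic (a := 0) (b := y) hint.integrableOn
      hint.integrableOn
    simp only [hK]
    linarith
  set g : ℝ → ℝ := fun w => K w / stdPDF w with hg
  have hgd : ∀ w, HasDerivAt g (w * g w + k w) w := by
    intro w
    refine ((hKd w).fun_div (hasDerivAt_stdPDF w) (stdPDF_pos w).ne').congr_deriv ?_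
    simp only [hg]
    have := (stdPDF_pos w).ne'
    field_simp
    ring
  have hgc : Continuous g := continuous_iff_continuousAt.2 fun w => (hgd w).continuousAt
  refine ⟨g, fun w => w * g w + k w, hgd, by fun_prop, fun w => by ring, fun w => ?_⟩
  have hwg : |w * g w| ≤ 1 := by
    simp only [hg]
    rw [mul_div_assoc', abs_div, abs_of_pos (stdPDF_pos w), div_le_one (stdPDF_pos w), abs_mul]
    rcases le_total 0 w with hw | hw
    · have h := intervalIntegral.integral_Iic_add_Ioi (b := w) hint.integrableOn
        hint.integrableOn
      rw [htot] at h
      have h1 : |K w| = |∫ t in Set.Ioi w, k t * stdPDF t| := by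
        rw [← abs_neg]
        congr 1
        linarith
      rw [abs_of_nonneg hw, h1]
      exact (mul_le_mul_of_nonneg_left (abs_setIntegral_mul_stdPDF_le hk _) hw).trans
        (mul_integral_Ioi_stdPDF_le hw)
    · rw [abs_of_nonpos hw]
      refine (mul_le_mul_of_nonneg_left (abs_setIntegral_mul_stdPDF_le hk _)
        (neg_nonneg.2 hw)).trans ?_
      have h := mul_integral_Ioi_stdPDF_le (neg_nonneg.2 hw)
      rw [← integral_comp_neg_Iic] at h
      simpa only [stdPDF_neg] using h
  calc |w * g w + k w| ≤ |w * g w| + |k w| := abs_add_le _ _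
    _ ≤ 2 := by linarith [hk w]

end SteinEquation

section TotalVariation

lemma dTV_le_of_continuous {μ ν : Measure ℝ} [IsProbabilityMeasure μ] [IsProbabilityMeasure ν]
    {D : ℝ} (h : ∀ f : ℝ → ℝ, Continuous f → (∀ t, 0 ≤ f t ∧ f t ≤ 1) →
      |∫ t, f t ∂μ - ∫ t, f t ∂ν| ≤ D) : dTV μ ν ≤ D := by
  have : Nonempty {s : Set ℝ // MeasurableSet s} := ⟨⟨∅, MeasurableSet.empty⟩⟩
  refine ciSup_le fun s => ?_
  obtain ⟨s, hs⟩ := s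
  refine le_of_forall_pos_le_add fun ε hε => ?_
  set χ : ℝ → ℝ := s.indicator 1 with hχ
  have hχi : ∀ (ρ : Measure ℝ) [IsFiniteMeasure ρ], Integrable χ ρ := fun ρ _ =>
    (integrable_const (1 : ℝ)).indicator hs
  obtain ⟨u, hu, hui⟩ := (hχi (μ + ν)).exists_boundedContinuous_integral_sub_le hε
  set f : ℝ → ℝ := fun t => max 0 (min 1 (u t)) with hf
  have hfc : Continuous f := by fun_prop
  have hf01 : ∀ t, 0 ≤ f t ∧ f t ≤ 1 := fun t =>
    ⟨le_max_left _ _, max_le zero_le_one (min_le_left _ _)⟩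
  have hfi : ∀ (ρ : Measure ℝ) [IsFiniteMeasure ρ], Integrable f ρ := fun ρ _ =>
    Integrable.mono' (integrable_const (1 : ℝ)) hfc.aestronglyMeasurable
      (Filter.Eventually.of_forall fun t => by
        rw [Real.norm_eq_abs, abs_of_nonneg (hf01 t).1]; exact (hf01 t).2)
  have hfu : ∀ t, |χ t - f t| ≤ ‖χ t - u t‖ := by
    intro t
    rw [Real.norm_eq_abs]
    by_cases ht : t ∈ s
    · simp only [hχ, hf, Set.indicator_of_mem ht, Pi.one_apply]
      grind
    · simp only [hχ, hf, Set.indicator_of_notMem ht]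
      grind
  have hle : (∫ t, |χ t - f t| ∂μ) + ∫ t, |χ t - f t| ∂ν ≤ ε := by
    have hd : ∀ (ρ : Measure ℝ) [IsFiniteMeasure ρ], Integrable (fun t => |χ t - f t|) ρ :=
      fun ρ _ => ((hχi ρ).sub (hfi ρ)).abs
    rw [← integral_add_measure (hd μ) (hd ν)]
    exact (integral_mono (hd _) ((hχi _).sub hui).norm hfu).trans hu
  have hind : ∀ (ρ : Measure ℝ), (ρ s).toReal = ∫ t, χ t ∂ρ := fun ρ => by
    rw [hχ, integral_indicator_one hs]; rfl
  have h1 : ∀ (ρ : Measure ℝ) [IsFiniteMeasure ρ],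
      |∫ t, χ t ∂ρ - ∫ t, f t ∂ρ| ≤ ∫ t, |χ t - f t| ∂ρ := fun ρ _ => by
    rw [← integral_sub (hχi ρ) (hfi ρ)]
    exact abs_integral_le_integral_abs
  have h2 := h f hfc hf01
  have h3 := h1 μ
  have h4 := h1 ν
  simp only [hind]
  rw [abs_le] at *
  constructor <;> linarith [h2.1, h2.2, h3.1, h3.2, h4.1, h4.2]

/-- Stein's method for the total variation distance to the standard Gaussian distribution. -/
lemma dTV_gaussianReal_le_of_stein {Ω : Type*} [MeasurableSpace Ω] {P : Measure Ω}
    [IsProbabilityMeasure P] {W : Ω → ℝ} (hW : Measurable W) {D : ℝ}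
    (h : ∀ g g' : ℝ → ℝ, (∀ w, HasDerivAt g (g' w) w) → Continuous g' → (∀ w, |g' w| ≤ 2) →
      |∫ x, (g' (W x) - W x * g (W x)) ∂P| ≤ D) :
    dTV (P.map W) (gaussianReal 0 1) ≤ D := by
  have : IsProbabilityMeasure (P.map W) := Measure.isProbabilityMeasure_map hW.aemeasurable
  refine dTV_le_of_continuous fun f hfc hf01 => ?_
  have hfi : ∀ (ρ : Measure ℝ) [IsFiniteMeasure ρ], Integrable f ρ := fun ρ _ =>
    Integrable.mono' (integrable_const (1 : ℝ)) hfc.aestronglyMeasurable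
      (Filter.Eventually.of_forall fun t => by
        rw [Real.norm_eq_abs, abs_of_nonneg (hf01 t).1]; exact (hf01 t).2)
  set m := ∫ t, f t ∂gaussianReal 0 1 with hm
  have hm0 : 0 ≤ m := integral_nonneg fun t => (hf01 t).1
  have hm1 : m ≤ 1 := by
    refine (integral_mono (hfi _) (integrable_const (1 : ℝ)) fun t => (hf01 t).2).trans ?_
    simp
  obtain ⟨g, g', hg, hg', hs, hb⟩ := exists_stein_solution (k := fun t => f t - m)
    (by fun_prop) (fun t => abs_le.2 ⟨by linarith [(hf01 t).1], by linarith [(hf01 t).2]⟩)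
    (by rw [integral_sub (hfi _) (integrable_const _)]; simp [hm])
  have h1 := h g g' hg hg' hb
  have h2 : ∫ t, f t ∂(P.map W) - m = ∫ x, (g' (W x) - W x * g (W x)) ∂P := by
    simp only [hs]
    rw [← integral_map (f := fun t => f t - m) hW.aemeasurable
      (by fun_prop : Continuous fun t => f t - m).aestronglyMeasurable,
      integral_sub (hfi _) (integrable_const _)]
    simp
  rwa [h2]

end TotalVariation

section SteinBound

open Polynomial

variable {ι : Type*} [Fintype ι] [DecidableEq ι]

lemma sq_integral_abs_le {Ω : Type*} [MeasurableSpace Ω] {P : Measure Ω} [IsProbabilityMeasure P]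
    {F : Ω → ℝ} (hF : Integrable F P) (hF2 : Integrable (fun x => F x ^ 2) P) :
    (∫ x, |F x| ∂P) ^ 2 ≤ ∫ x, F x ^ 2 ∂P := by
  set m := ∫ x, |F x| ∂P with hm
  have h0 : 0 ≤ ∫ x, (|F x| - m) ^ 2 ∂P := integral_nonneg fun x => sq_nonneg _
  have h1 : ∫ x, (|F x| - m) ^ 2 ∂P = ∫ x, F x ^ 2 ∂P - 2 * m * m + m ^ 2 := by
    have he : ∀ x, (|F x| - m) ^ 2 = F x ^ 2 - 2 * m * |F x| + m ^ 2 := fun x => by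
      rw [← sq_abs (F x)]; ring
    simp only [he]
    have hi : Integrable (fun x => F x ^ 2 - 2 * m * |F x|) P := hF2.sub (hF.abs.const_mul _)
    rw [integral_add hi (integrable_const _),
      integral_sub hF2 (hF.abs.const_mul _), integral_const_mul]
    simp [hm]
  linarith

/-- Fluctuations of weighted sums of even powers of the coordinates of a random point of the
sphere. -/
lemma pow_mul_integral_abs_sum_pow_sub_le [Nontrivial ι] (a : ι → ℝ) (p : ℕ) :
    (Fintype.card ι : ℝ) ^ p * ∫ x, |∑ k, a k ^ 2 * ((x : EuclideanSpace ℝ ι) k ^ (2 * p) -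
      coordMoment (Fintype.card ι) (2 * p))| ∂sphereUniform ι ≤
      √(oddProd (2 * p) * ∑ k, a k ^ 4) := by
  set n := Fintype.card ι with hn
  have hn0 : 0 < n := Fintype.card_pos
  set M := coordMoment n (2 * p) with hM
  have hMv : ∀ i, ∫ x, (x : EuclideanSpace ℝ ι) i ^ (2 * p) ∂sphereUniform ι = M := fun i => by
    rw [integral_sphere_pow_even, hM, coordMoment_even]
  have hpair : ∀ i j, ∫ x, ((x : EuclideanSpace ℝ ι) i ^ (2 * p) - M) *
      ((x : EuclideanSpace ℝ ι) j ^ (2 * p) - M) ∂sphereUniform ι =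
      ∫ x, (x : EuclideanSpace ℝ ι) i ^ (2 * p) * (x : EuclideanSpace ℝ ι) j ^ (2 * p)
        ∂sphereUniform ι - M ^ 2 := fun i j => by
    have he : ∀ x : Metric.sphere (0 : EuclideanSpace ℝ ι) 1,
        ((x : EuclideanSpace ℝ ι) i ^ (2 * p) - M) * ((x : EuclideanSpace ℝ ι) j ^ (2 * p) - M) =
        (x : EuclideanSpace ℝ ι) i ^ (2 * p) * (x : EuclideanSpace ℝ ι) j ^ (2 * p)
          - M * (x : EuclideanSpace ℝ ι) i ^ (2 * p) - M * (x : EuclideanSpace ℝ ι) j ^ (2 * p)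
          + M ^ 2 := fun x => by ring
    have i1 := integrable_sphere (f := fun x : EuclideanSpace ℝ ι => x i ^ (2 * p) * x j ^ (2 * p))
      (by fun_prop)
    have i2 := fun i => integrable_sphere (f := fun x : EuclideanSpace ℝ ι => M * x i ^ (2 * p))
      (by fun_prop)
    have i3 := integrable_sphere (f := fun x : EuclideanSpace ℝ ι =>
      x i ^ (2 * p) * x j ^ (2 * p) - M * x i ^ (2 * p)) (by fun_prop)
    have i4 := integrable_sphere (f := fun x : EuclideanSpace ℝ ι =>
      x i ^ (2 * p) * x j ^ (2 * p) - M * x i ^ (2 * p) - M * x j ^ (2 * p)) (by fun_prop)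
    simp only [he]
    rw [integral_add i4 (integrable_const _), integral_sub i3 (i2 j),
      integral_sub i1 (i2 i), integral_const_mul, integral_const_mul, hMv, hMv]
    simp
    ring
  have hoff : ∀ i j, i ≠ j → ∫ x, ((x : EuclideanSpace ℝ ι) i ^ (2 * p) - M) *
      ((x : EuclideanSpace ℝ ι) j ^ (2 * p) - M) ∂sphereUniform ι ≤ 0 := fun i j hij => by
    rw [hpair, integral_sphere_pow_even_mul_pow_even hij, hM, coordMoment_even, div_pow,
      ← sq, sub_nonpos]
    refine div_le_div_of_nonneg_left (sq_nonneg _) (pow_pos (stepProd_pos hn0 p) 2) ?_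
    rw [sq]
    exact stepProd_mul_le n p p
  have hdiag : ∀ i, ∫ x, ((x : EuclideanSpace ℝ ι) i ^ (2 * p) - M) *
      ((x : EuclideanSpace ℝ ι) i ^ (2 * p) - M) ∂sphereUniform ι ≤
        coordMoment n (2 * (2 * p)) := fun i => by
    rw [hpair]
    simp only [← pow_add]
    rw [show 2 * p + 2 * p = 2 * (2 * p) by ring, integral_sphere_pow_even, ← hn,
      ← coordMoment_even]
    linarith [sq_nonneg M]
  have hc : Continuous fun x : EuclideanSpace ℝ ι => ∑ k, a k ^ 2 * (x k ^ (2 * p) - M) := by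
    fun_prop
  have hvar : ∫ x, (∑ k, a k ^ 2 * ((x : EuclideanSpace ℝ ι) k ^ (2 * p) - M)) ^ 2
      ∂sphereUniform ι ≤ coordMoment n (2 * (2 * p)) * ∑ k, a k ^ 4 := by
    have he : ∀ x : Metric.sphere (0 : EuclideanSpace ℝ ι) 1,
        (∑ k, a k ^ 2 * ((x : EuclideanSpace ℝ ι) k ^ (2 * p) - M)) ^ 2 =
        ∑ i, ∑ j, a i ^ 2 * a j ^ 2 * (((x : EuclideanSpace ℝ ι) i ^ (2 * p) - M) *
          ((x : EuclideanSpace ℝ ι) j ^ (2 * p) - M)) := fun x => by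
      rw [sq, Finset.sum_mul_sum]
      exact Finset.sum_congr rfl fun i _ => Finset.sum_congr rfl fun j _ => by ring
    simp only [he]
    rw [integral_finsetSum _ fun i _ => integrable_sphere (f := fun x : EuclideanSpace ℝ ι =>
      ∑ j, a i ^ 2 * a j ^ 2 * ((x i ^ (2 * p) - M) * (x j ^ (2 * p) - M))) (by fun_prop),
      Finset.mul_sum]
    refine Finset.sum_le_sum fun i _ => ?_
    rw [integral_finsetSum _ fun j _ => integrable_sphere (f := fun x : EuclideanSpace ℝ ι =>
      a i ^ 2 * a j ^ 2 * ((x i ^ (2 * p) - M) * (x j ^ (2 * p) - M))) (by fun_prop),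
      ← Finset.add_sum_erase _ _ (Finset.mem_univ i)]
    simp only [integral_const_mul]
    have h1 := mul_le_mul_of_nonneg_left (hdiag i) (mul_nonneg (sq_nonneg (a i)) (sq_nonneg (a i)))
    have h2 : ∑ j ∈ Finset.univ.erase i, a i ^ 2 * a j ^ 2 *
        ∫ x, ((x : EuclideanSpace ℝ ι) i ^ (2 * p) - M) *
          ((x : EuclideanSpace ℝ ι) j ^ (2 * p) - M) ∂sphereUniform ι ≤ 0 :=
      Finset.sum_nonpos fun j hj => mul_nonpos_of_nonneg_of_nonpos (by positivity)
        (hoff i j (Finset.ne_of_mem_erase hj).symm)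
    nlinarith
  have hsq := (sq_integral_abs_le (integrable_sphere hc)
    (integrable_sphere (f := fun x : EuclideanSpace ℝ ι =>
      (∑ k, a k ^ 2 * (x k ^ (2 * p) - M)) ^ 2) (by fun_prop))).trans hvar
  refine Real.le_sqrt_of_sq_le ?_
  rw [mul_pow, ← pow_mul]
  calc (n : ℝ) ^ (p * 2) * _ ≤ (n : ℝ) ^ (p * 2) * (coordMoment n (2 * (2 * p)) * ∑ k, a k ^ 4) :=
        mul_le_mul_of_nonneg_left hsq (by positivity)
    _ = (n : ℝ) ^ (2 * p) * coordMoment n (2 * (2 * p)) * ∑ k, a k ^ 4 := by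
        rw [mul_comm p 2, mul_assoc]
    _ ≤ _ := mul_le_mul_of_nonneg_right (pow_mul_coordMoment_le hn0 (2 * p))
        (Finset.sum_nonneg fun k _ => by positivity)

lemma integral_sq_sum_odd [Nontrivial ι] (a : ι → ℝ) {F : ℝ → ℝ} (hF : Continuous F)
    (hodd : ∀ t, F (-t) = -F t) :
    ∫ x, (∑ k, a k * F ((x : EuclideanSpace ℝ ι) k)) ^ 2 ∂sphereUniform ι =
      ∑ k, a k ^ 2 * ∫ x, F ((x : EuclideanSpace ℝ ι) k) ^ 2 ∂sphereUniform ι := by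
  have he : ∀ x : Metric.sphere (0 : EuclideanSpace ℝ ι) 1,
      (∑ k, a k * F ((x : EuclideanSpace ℝ ι) k)) ^ 2 =
      ∑ i, ∑ j, a i * a j * (F ((x : EuclideanSpace ℝ ι) i) * F ((x : EuclideanSpace ℝ ι) j)) :=
    fun x => by
      rw [sq, Finset.sum_mul_sum]
      exact Finset.sum_congr rfl fun i _ => Finset.sum_congr rfl fun j _ => by ring
  simp only [he]
  rw [integral_finsetSum _ fun i _ => integrable_sphere (f := fun x : EuclideanSpace ℝ ι =>
    ∑ j, a i * a j * (F (x i) * F (x j))) (by fun_prop)]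
  refine Finset.sum_congr rfl fun i _ => ?_
  rw [integral_finsetSum _ fun j _ => integrable_sphere (f := fun x : EuclideanSpace ℝ ι =>
    a i * a j * (F (x i) * F (x j))) (by fun_prop)]
  simp only [integral_const_mul]
  rw [Finset.sum_eq_single i]
  · simp only [sq]
  · intro j _ hj
    rw [integral_sphere_odd_mul_odd (Ne.symm hj) hF hodd, mul_zero]
  · simp

/-- Stein bound for linear combinations of zonal eigenfunctions. -/
lemma dTV_sum_eval_le [Nontrivial ι] {a : ι → ℝ} (ha : ∑ k, a k ^ 2 = 1) {φ : Polynomial ℝ} {μ : ℝ}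
    (hμ : 0 < μ)
    (hφ : (1 - X ^ 2) * derivative (derivative φ) - C ((Fintype.card ι : ℝ) - 1) * X * derivative φ
      = -C μ * φ)
    (hnorm : coordMean (Fintype.card ι) (φ ^ 2) = 1)
    (heven : ∀ t, (derivative φ).eval (-t) = (derivative φ).eval t) :
    μ * dTV ((sphereUniform ι).map fun x : Metric.sphere (0 : EuclideanSpace ℝ ι) 1 =>
        ∑ k, a k * φ.eval ((x : EuclideanSpace ℝ ι) k))
        (gaussianReal 0 1) ≤
      2 * (∫ x, |∑ k, a k ^ 2 * ((derivative φ ^ 2).eval ((x : EuclideanSpace ℝ ι) k) -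
          coordMean (Fintype.card ι) (derivative φ ^ 2))| ∂sphereUniform ι) +
        4 * coordMean (Fintype.card ι) (X ^ 2 * derivative φ ^ 2) := by
  set n := Fintype.card ι with hn
  have hn0 : 0 < n := Fintype.card_pos
  set V := derivative φ ^ 2 with hV
  set v := coordMean n V with hv
  set r := coordMean n (X ^ 2 * V) with hr
  set I := ∫ x, |∑ k, a k ^ 2 * (V.eval ((x : EuclideanSpace ℝ ι) k) - v)| ∂sphereUniform ι with hI
  have hμv : μ = v - r := by
    have h := coordMean_sq_of_ode hn0 hφ
    rw [hnorm, mul_one, sub_mul, one_mul, map_sub] at h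
    exact h
  obtain ⟨i₀⟩ : Nonempty ι := inferInstance
  have hrint : ∀ k, ∫ x, ((x : EuclideanSpace ℝ ι) k *
      (derivative φ).eval ((x : EuclideanSpace ℝ ι) k)) ^ 2 ∂sphereUniform ι = r := fun k => by
    rw [hr, hn, ← integral_sphere_eval k]
    refine integral_congr_ae (Filter.Eventually.of_forall fun x => ?_)
    simp [hV, mul_pow]
  have hr0 : 0 ≤ r := by
    rw [← hrint i₀]
    exact integral_nonneg fun x => sq_nonneg _
  rw [← le_div_iff₀' hμ]
  refine dTV_gaussianReal_le_of_stein ?_ fun g g' hg hg' hb => ?_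
  · exact ((by fun_prop : Continuous fun x : EuclideanSpace ℝ ι =>
      ∑ k, a k * φ.eval (x k)).comp continuous_subtype_val).measurable
  have hgc : Continuous g := continuous_iff_continuousAt.2 fun w => (hg w).continuousAt
  set W : EuclideanSpace ℝ ι → ℝ := fun x => ∑ k, a k * φ.eval (x k) with hW
  set T : EuclideanSpace ℝ ι → ℝ := fun x => ∑ k, a k * (x k * (derivative φ).eval (x k)) with hT
  set S : EuclideanSpace ℝ ι → ℝ := fun x => ∑ k, a k ^ 2 * (V.eval (x k) - v) with hS
  have hWc : Continuous W := by fun_prop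
  have hTc : Continuous T := by fun_prop
  have hSc : Continuous S := by fun_prop
  have key := integral_sum_mul_comp_sum a φ (μ := μ) (fun t => by
    have := congrArg (Polynomial.eval t) hφ
    simpa using this) hg hg'
  have hSsum : ∀ x : EuclideanSpace ℝ ι,
      ∑ m, a m ^ 2 * (derivative φ).eval (x m) ^ 2 = S x + v := fun x => by
    simp only [hS, hV, mul_sub, Finset.sum_sub_distrib, Polynomial.eval_pow]
    rw [← Finset.sum_mul, ha]
    ring
  simp only [hSsum] at key
  change ∫ x : Metric.sphere (0 : EuclideanSpace ℝ ι) 1,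
    (μ * (W x * g (W x)) - g' (W x) * (S x + v - T x ^ 2)) ∂sphereUniform ι = 0 at key
  have hmain : μ * ∫ x : Metric.sphere (0 : EuclideanSpace ℝ ι) 1, (g' (W x) - W x * g (W x))
      ∂sphereUniform ι = ∫ x : Metric.sphere (0 : EuclideanSpace ℝ ι) 1,
        g' (W x) * (-r - S x + T x ^ 2) ∂sphereUniform ι := by
    rw [← integral_const_mul, eq_comm, ← sub_eq_zero, ← integral_sub
      (integrable_sphere (f := fun x => g' (W x) * (-r - S x + T x ^ 2)) (by fun_prop))
      (integrable_sphere (f := fun x => μ * (g' (W x) - W x * g (W x))) (by fun_prop))]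
    refine Eq.trans ?_ key
    refine integral_congr_ae (Filter.Eventually.of_forall fun x => ?_)
    simp only [hμv]
    ring
  have hTint : ∫ x : Metric.sphere (0 : EuclideanSpace ℝ ι) 1, T x ^ 2 ∂sphereUniform ι = r := by
    rw [hT, integral_sq_sum_odd a (F := fun t => t * (derivative φ).eval t) (by fun_prop)
      (fun t => by rw [heven]; ring)]
    simp only [hrint]
    rw [← Finset.sum_mul, ha, one_mul]
  rw [le_div_iff₀' hμ, ← abs_of_pos hμ, ← abs_mul, hmain]
  have iS := integrable_sphere (ι := ι) (f := fun x => |S x|) (by fun_prop)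
  have iT := integrable_sphere (ι := ι) (f := fun x => T x ^ 2) (by fun_prop)
  calc |∫ x : Metric.sphere (0 : EuclideanSpace ℝ ι) 1, g' (W x) * (-r - S x + T x ^ 2)
        ∂sphereUniform ι|
      ≤ ∫ x : Metric.sphere (0 : EuclideanSpace ℝ ι) 1, |g' (W x) * (-r - S x + T x ^ 2)|
        ∂sphereUniform ι := abs_integral_le_integral_abs
    _ ≤ ∫ x : Metric.sphere (0 : EuclideanSpace ℝ ι) 1, 2 * (r + |S x| + T x ^ 2)
        ∂sphereUniform ι := by
        refine integral_mono
          (integrable_sphere (f := fun x => |g' (W x) * (-r - S x + T x ^ 2)|) (by fun_prop))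
          (integrable_sphere (f := fun x => 2 * (r + |S x| + T x ^ 2)) (by fun_prop)) fun x => ?_
        simp only [abs_mul]
        refine mul_le_mul (hb _) ?_ (abs_nonneg _) zero_le_two
        rw [abs_le]
        have h1 := abs_le.1 (le_refl |S x|)
        have h2 := sq_nonneg (T x)
        constructor <;> linarith [h1.1, h1.2]
    _ = 2 * I + 4 * r := by
        have irS := integrable_sphere (ι := ι) (f := fun x => r + |S x|) (by fun_prop)
        rw [integral_const_mul, integral_add irS iT,
          integral_add (integrable_const r) iS, hTint]
        simp [hI]
        ring

/-- Bound for even polynomials whose coefficients have the natural scaling in the dimension. -/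
lemma integral_abs_sum_eval_sub_add_coordMean_le [Nontrivial ι] {a : ι → ℝ}
    (ha : ∑ k, a k ^ 2 = 1) {σ : Type*} (s : Finset σ) (p : σ → ℕ) (e : σ → ℝ) {B : ℝ}
    (he : ∀ i ∈ s, |e i| ≤ B * (Fintype.card ι : ℝ) ^ p i) (hB : 0 ≤ B) :
    2 * (∫ x, |∑ k, a k ^ 2 * ((∑ i ∈ s, monomial (2 * p i) (e i)).eval
        ((x : EuclideanSpace ℝ ι) k) -
          coordMean (Fintype.card ι) (∑ i ∈ s, monomial (2 * p i) (e i)))| ∂sphereUniform ι) +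
        4 * coordMean (Fintype.card ι) (X ^ 2 * ∑ i ∈ s, monomial (2 * p i) (e i)) ≤
      B * (∑ i ∈ s, (2 * √(oddProd (2 * p i)) + 4 * oddProd (p i + 1))) * √(∑ k, a k ^ 4) := by
  set n := Fintype.card ι with hn
  have hn0 : 0 < n := Fintype.card_pos
  have hnR : (0 : ℝ) < n := by exact_mod_cast hn0
  set R := √(∑ k, a k ^ 4) with hR
  have hsum4 : ∑ k, a k ^ 4 ≤ 1 := by
    have hle : ∀ k, a k ^ 2 ≤ 1 := fun k => by
      rw [← ha]
      exact Finset.single_le_sum (f := fun k => a k ^ 2) (fun i _ => sq_nonneg _)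
        (Finset.mem_univ k)
    rw [← ha]
    exact Finset.sum_le_sum fun k _ => by nlinarith [hle k, sq_nonneg (a k)]
  have hcs : (n : ℝ)⁻¹ ≤ R := by
    have h1 : 1 ≤ n * ∑ k, a k ^ 4 := by
      have h := sq_sum_le_card_mul_sum_sq (s := Finset.univ) (f := fun k => a k ^ 2)
      rw [ha] at h
      simpa [← pow_mul, hn] using h
    have h2 : (n : ℝ)⁻¹ ≤ ∑ k, a k ^ 4 := by rwa [inv_le_iff_one_le_mul₀' hnR]
    have h0 : 0 ≤ ∑ k, a k ^ 4 := (inv_nonneg.2 hnR.le).trans h2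
    exact h2.trans (Real.le_sqrt_of_sq_le (by nlinarith))
  have hfl : ∫ x, |∑ k, a k ^ 2 * ((∑ i ∈ s, monomial (2 * p i) (e i)).eval
      ((x : EuclideanSpace ℝ ι) k) - coordMean n (∑ i ∈ s, monomial (2 * p i) (e i)))|
        ∂sphereUniform ι ≤ ∑ i ∈ s, B * (√(oddProd (2 * p i)) * R) := by
    have hc : ∀ i, Continuous fun x : EuclideanSpace ℝ ι => |e i| *
        |∑ k, a k ^ 2 * (x k ^ (2 * p i) - coordMoment n (2 * p i))| := fun i => by fun_prop
    calc _ ≤ ∫ x, ∑ i ∈ s, |e i| * |∑ k, a k ^ 2 * ((x : EuclideanSpace ℝ ι) k ^ (2 * p i) -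
          coordMoment n (2 * p i))| ∂sphereUniform ι := by
          refine integral_mono
            (integrable_sphere (f := fun x : EuclideanSpace ℝ ι => |∑ k, a k ^ 2 *
              ((∑ i ∈ s, monomial (2 * p i) (e i)).eval (x k) -
                coordMean n (∑ i ∈ s, monomial (2 * p i) (e i)))|) (by fun_prop))
            (integrable_finsetSum _ fun i _ => integrable_sphere (hc i)) fun x => ?_
          refine le_trans (le_of_eq ?_) ((Finset.abs_sum_le_sum_abs
            (fun i => e i * ∑ k, a k ^ 2 * ((x : EuclideanSpace ℝ ι) k ^ (2 * p i) -
              coordMoment n (2 * p i))) s).trans_eq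
            (Finset.sum_congr rfl fun i _ => abs_mul _ _))
          congr 1
          simp only [Finset.mul_sum]
          rw [Finset.sum_comm]
          refine Finset.sum_congr rfl fun k _ => ?_
          rw [Polynomial.eval_finsetSum, map_sum, ← Finset.sum_sub_distrib, Finset.mul_sum]
          refine Finset.sum_congr rfl fun i _ => ?_
          rw [coordMean_monomial, Polynomial.eval_monomial]
          ring
      _ = ∑ i ∈ s, |e i| * ∫ x, |∑ k, a k ^ 2 * ((x : EuclideanSpace ℝ ι) k ^ (2 * p i) -
          coordMoment n (2 * p i))| ∂sphereUniform ι := by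
          rw [integral_finsetSum _ fun i _ => integrable_sphere (hc i)]
          simp only [integral_const_mul]
      _ ≤ _ := by
          refine Finset.sum_le_sum fun i hi => ?_
          rw [hR, ← Real.sqrt_mul (oddProd_pos _).le]
          refine (mul_le_mul_of_nonneg_right (he i hi)
            (integral_nonneg fun x => abs_nonneg _)).trans ?_
          rw [mul_assoc]
          exact mul_le_mul_of_nonneg_left (pow_mul_integral_abs_sum_pow_sub_le a (p i)) hB
  have hrem : coordMean n (X ^ 2 * ∑ i ∈ s, monomial (2 * p i) (e i)) ≤
      ∑ i ∈ s, B * (oddProd (p i + 1) * R) := by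
    rw [Finset.mul_sum, map_sum]
    refine Finset.sum_le_sum fun i hi => ?_
    rw [Polynomial.X_pow_mul_monomial, show 2 * p i + 2 = 2 * (p i + 1) by ring,
      coordMean_monomial]
    have h0 : 0 ≤ coordMoment n (2 * (p i + 1)) := by
      rw [coordMoment_even]
      exact (div_pos (oddProd_pos _) (stepProd_pos hn0 _)).le
    have h1 := pow_mul_coordMoment_le hn0 (p i + 1)
    calc coordMoment n (2 * (p i + 1)) * e i
        ≤ coordMoment n (2 * (p i + 1)) * (B * (n : ℝ) ^ p i) :=
          mul_le_mul_of_nonneg_left ((le_abs_self _).trans (he i hi)) h0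
      _ = B * ((n : ℝ) ^ (p i + 1) * coordMoment n (2 * (p i + 1)) * (n : ℝ)⁻¹) := by
          field_simp
          ring
      _ ≤ B * (oddProd (p i + 1) * R) := by
          refine mul_le_mul_of_nonneg_left ?_ hB
          exact mul_le_mul h1 hcs (inv_nonneg.2 hnR.le) (oddProd_pos _).le
  refine (add_le_add (mul_le_mul_of_nonneg_left hfl zero_le_two)
    (mul_le_mul_of_nonneg_left hrem zero_le_four)).trans_eq ?_
  rw [Finset.mul_sum, Finset.mul_sum, ← Finset.sum_add_distrib, Finset.mul_sum, Finset.sum_mul]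
  exact Finset.sum_congr rfl fun i _ => by ring

end SteinBound

section GegenbauerBounds

open Polynomial

lemma eval_neg_gegenbauerPoly_of_even (k : ℝ) {m : ℕ} (hm : Even m) (t : ℝ) :
    (gegenbauerPoly k m).eval (-t) = (gegenbauerPoly k m).eval t := by
  simp only [gegenbauerPoly, Polynomial.eval_finsetSum, Polynomial.eval_monomial]
  refine Finset.sum_congr rfl fun j _ => ?_
  rw [Even.neg_pow (Even.tsub hm (even_two_mul j))]

lemma risingProd_nonneg {k : ℝ} (hk : 0 ≤ k) (r : ℕ) : 0 ≤ risingProd k r :=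
  Finset.prod_nonneg fun i _ => by positivity

lemma risingProd_le {k x : ℝ} (hk : 0 ≤ k) (hkx : k ≤ x) (hx : 1 ≤ x) {r m : ℕ} (hr : r ≤ m) :
    risingProd k r ≤ (m + 1) ^ m * x ^ r := by
  have h1 : risingProd k r ≤ ∏ _i ∈ Finset.range r, ((m + 1 : ℝ) * x) := by
    refine Finset.prod_le_prod (fun i _ => by positivity) fun i hi => ?_
    have hi' : (i : ℝ) ≤ m := by
      exact_mod_cast (Finset.mem_range.1 hi).le.trans hr
    nlinarith [Nat.cast_nonneg (α := ℝ) i]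
  rw [Finset.prod_const, Finset.card_range, mul_pow] at h1
  refine h1.trans (mul_le_mul_of_nonneg_right ?_ (by positivity))
  exact pow_le_pow_right₀ (by linarith [Nat.cast_nonneg (α := ℝ) m]) hr

lemma abs_gegenbauerCoeff_le {k x : ℝ} (hk : 0 ≤ k) (hkx : k ≤ x) (hx : 1 ≤ x) (m j : ℕ) :
    |gegenbauerCoeff k m j| ≤ (2 * (m + 1)) ^ m * x ^ (m - j) := by
  have hd : (1 : ℝ) ≤ j.factorial * (m - 2 * j).factorial := by
    exact_mod_cast Nat.one_le_iff_ne_zero.2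
      (mul_ne_zero j.factorial_ne_zero (m - 2 * j).factorial_ne_zero)
  rw [gegenbauerCoeff, abs_div, abs_mul, abs_mul, abs_pow, abs_neg, abs_one, one_pow, one_mul,
    abs_of_nonneg (risingProd_nonneg hk _), abs_of_nonneg (zero_le_one.trans hd),
    abs_of_nonneg (by positivity : (0 : ℝ) ≤ 2 ^ (m - 2 * j)), mul_pow, mul_assoc]
  refine (div_le_self (mul_nonneg (by positivity) (risingProd_nonneg hk _)) hd).trans ?_
  exact mul_le_mul (pow_le_pow_right₀ one_le_two (Nat.sub_le _ _))
    (risingProd_le hk hkx hx (Nat.sub_le _ _)) (risingProd_nonneg hk _) (by positivity)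

lemma Aconst_sq (N ℓ : ℕ) : Aconst (N + 3) ℓ ^ 2 =
    (N.factorial * ℓ.factorial * (N + 1 + 2 * ℓ)) / ((N + ℓ).factorial * (N + 1)) := by
  rw [Aconst, show N + 3 - 3 = N by omega, show N + 3 + ℓ - 3 = N + ℓ by omega, Real.sq_sqrt]
  · push_cast
    congr 1 <;> ring
  · push_cast
    rw [show (N : ℝ) + 3 + 2 * ℓ - 2 = N + 1 + 2 * ℓ by ring,
      show (N : ℝ) + 3 - 2 = N + 1 by ring]
    positivity

lemma Aconst_sq_mul_le (N m : ℕ) : Aconst (N + 3) (m + 1) ^ 2 * (N + 1) * ((N : ℝ) + 3) ^ m ≤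
    (m + 1).factorial * 3 ^ m * (2 * m + 3) := by
  have hf : (N.factorial : ℝ) * (N + 1) ^ (m + 1) ≤ (N + (m + 1)).factorial := by
    exact_mod_cast Nat.factorial_mul_pow_le_factorial
  have hN : (0 : ℝ) < N + 1 := by positivity
  have h3 : ((N : ℝ) + 3) ^ m ≤ 3 ^ m * (N + 1) ^ m := by
    rw [← mul_pow]
    exact pow_le_pow_left₀ (by positivity) (by linarith [Nat.cast_nonneg (α := ℝ) N]) m
  have h4 : (N : ℝ) + 1 + 2 * (m + 1) ≤ (2 * m + 3) * (N + 1) := by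
    nlinarith [mul_nonneg (Nat.cast_nonneg (α := ℝ) N) (Nat.cast_nonneg (α := ℝ) m),
      Nat.cast_nonneg (α := ℝ) N]
  rw [Aconst_sq, div_mul_eq_mul_div, div_mul_eq_mul_div, div_le_iff₀ (by positivity)]
  push_cast
  calc (N.factorial : ℝ) * (m + 1).factorial * (N + 1 + 2 * (m + 1)) * (N + 1) * (N + 3) ^ m
      ≤ (N.factorial : ℝ) * (m + 1).factorial * ((2 * m + 3) * (N + 1)) * (N + 1) *
          (3 ^ m * (N + 1) ^ m) := by gcongr
    _ = (m + 1).factorial * 3 ^ m * (2 * m + 3) *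
          ((N.factorial * (N + 1) ^ (m + 1)) * (N + 1)) := by ring
    _ ≤ _ := by gcongr

/-- The square of the derivative of the normalized Gegenbauer polynomial, expanded. -/
lemma sq_C_mul_gegenbauerPoly (b k : ℝ) (m : ℕ) :
    (C b * gegenbauerPoly k m) ^ 2 =
      ∑ i ∈ Finset.range (m / 2 + 1) ×ˢ Finset.range (m / 2 + 1),
        monomial (2 * (m - i.1 - i.2))
          (b ^ 2 * (gegenbauerCoeff k m i.1 * gegenbauerCoeff k m i.2)) := by
  rw [mul_pow, ← C_pow, sq (gegenbauerPoly k m), gegenbauerPoly, Finset.sum_mul_sum,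
    ← Finset.sum_product', Finset.mul_sum]
  refine Finset.sum_congr rfl fun i hi => ?_
  obtain ⟨h1, h2⟩ := Finset.mem_product.1 hi
  rw [Finset.mem_range] at h1 h2
  rw [monomial_mul_monomial, C_mul_monomial]
  congr 1
  congr 1
  omega

/-- The constant in the total variation bound for degree `m + 1`. -/
def tvConst (m : ℕ) : ℝ :=
  (m + 1).factorial * 3 ^ m * (2 * m + 3) * ((2 * (m + 1)) ^ m) ^ 2 *
    ∑ i ∈ Finset.range (m / 2 + 1) ×ˢ Finset.range (m / 2 + 1),
      (2 * √(oddProd (2 * (m - i.1 - i.2))) + 4 * oddProd (m - i.1 - i.2 + 1))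

lemma tvConst_pos (m : ℕ) : 0 < tvConst m := by
  refine mul_pos (by positivity) (Finset.sum_pos (fun i _ => ?_) ⟨(0, 0), by simp⟩)
  have := oddProd_pos (m - i.1 - i.2 + 1)
  positivity

lemma dTV_sum_pli_le {m : ℕ} (hm : Even m) (N : ℕ) {a : Fin (N + 3) → ℝ}
    (ha : ∑ i, a i ^ 2 = 1) :
    dTV ((sphereUniform (Fin (N + 3))).map
        fun x : Metric.sphere (0 : EuclideanSpace ℝ (Fin (N + 3))) 1 =>
          ∑ i, a i * pli (N + 3) (m + 1) i x) (gaussianReal 0 1) ≤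
      tvConst m * √(∑ i, a i ^ 4) := by
  set A := Aconst (N + 3) (m + 1) with hA
  set k : ℝ := ((N : ℝ) + 1) / 2 with hk
  have hk0 : 0 < k := by positivity
  set φ : ℝ[X] := C A * gegenbauerPoly k (m + 1) with hφ
  set μ : ℝ := ((m + 1 : ℕ) : ℝ) * ((m + 1 : ℕ) + 2 * k) with hμ
  have hμ0 : 0 < μ := by positivity
  have hcard : Fintype.card (Fin (N + 3)) = N + 3 := Fintype.card_fin _
  have hφ' : derivative φ = C (A * (2 * k)) * gegenbauerPoly (k + 1) m := by
    rw [hφ, derivative_C_mul, derivative_gegenbauerPoly, ← mul_assoc, ← C_mul]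
  have hode : (1 - X ^ 2) * derivative (derivative φ) -
      C ((Fintype.card (Fin (N + 3)) : ℝ) - 1) * X * derivative φ = -C μ * φ := by
    have h := gegenbauerPoly_ode k (m + 1)
    rw [hcard, show (((N + 3 : ℕ) : ℝ) - 1) = 2 * k + 1 by rw [hk]; push_cast; ring, hφ,
      derivative_C_mul, derivative_C_mul]
    linear_combination C A * h
  have hnorm : coordMean (Fintype.card (Fin (N + 3))) (φ ^ 2) = 1 := by
    rw [hcard, hφ, mul_pow, ← C_pow, ← smul_eq_C_mul, map_smul, coordMean_gegenbauerPoly_sq,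
      smul_eq_mul, hA, Aconst_sq]
    have h1 := Nat.cast_ne_zero (R := ℝ).2 (N + (m + 1)).factorial_ne_zero
    have h2 := Nat.cast_ne_zero (R := ℝ).2 N.factorial_ne_zero
    have h3 := Nat.cast_ne_zero (R := ℝ).2 (m + 1).factorial_ne_zero
    have h4 : (N : ℝ) + 1 ≠ 0 := by positivity
    have h5 : (N : ℝ) + 1 + 2 * ((m + 1 : ℕ) : ℝ) ≠ 0 := by positivity
    field_simp
  have heven : ∀ t, (derivative φ).eval (-t) = (derivative φ).eval t := fun t => by
    rw [hφ', eval_mul, eval_mul, eval_C, eval_C, eval_neg_gegenbauerPoly_of_even _ hm]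
  have hpli : (fun x : Metric.sphere (0 : EuclideanSpace ℝ (Fin (N + 3))) 1 =>
      ∑ i, a i * pli (N + 3) (m + 1) i x) = fun x : Metric.sphere (0 : EuclideanSpace ℝ _) 1 =>
        ∑ i, a i * φ.eval ((x : EuclideanSpace ℝ (Fin (N + 3))) i) := by
    funext x
    refine Finset.sum_congr rfl fun i _ => ?_
    rw [pli, hφ, eval_mul, eval_C, eval_gegenbauerPoly hk0, hA, hk]
    congr 4
    push_cast
    ring
  have hstein := dTV_sum_eval_le ha hμ0 hode hnorm heven
  set K : ℝ := (2 * (m + 1)) ^ m with hK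
  have hcoeff : ∀ i ∈ Finset.range (m / 2 + 1) ×ˢ Finset.range (m / 2 + 1),
      |(A * (2 * k)) ^ 2 * (gegenbauerCoeff (k + 1) m i.1 * gegenbauerCoeff (k + 1) m i.2)| ≤
        μ * ((m + 1).factorial * 3 ^ m * (2 * m + 3) * K ^ 2) *
          (Fintype.card (Fin (N + 3)) : ℝ) ^ (m - i.1 - i.2) := by
    intro i hi
    obtain ⟨h1, h2⟩ := Finset.mem_product.1 hi
    rw [Finset.mem_range] at h1 h2
    have hc := fun j => abs_gegenbauerCoeff_le (k := k + 1) (x := (N : ℝ) + 3) (by positivity)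
      (by rw [hk]; linarith [Nat.cast_nonneg (α := ℝ) N])
      (by linarith [Nat.cast_nonneg (α := ℝ) N]) m j
    have h2k : 2 * k = N + 1 := by rw [hk]; ring
    have hμN : (N : ℝ) + 1 ≤ μ := by
      rw [hμ, h2k]
      push_cast
      nlinarith [mul_nonneg (Nat.cast_nonneg (α := ℝ) N) (Nat.cast_nonneg (α := ℝ) m),
        Nat.cast_nonneg (α := ℝ) m]
    rw [hcard, abs_mul, abs_mul, abs_of_nonneg (sq_nonneg _), mul_pow, h2k]
    push_cast
    calc A ^ 2 * ((N : ℝ) + 1) ^ 2 *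
          (|gegenbauerCoeff (k + 1) m i.1| * |gegenbauerCoeff (k + 1) m i.2|)
        ≤ A ^ 2 * ((N : ℝ) + 1) ^ 2 *
          ((K * ((N : ℝ) + 3) ^ (m - i.1)) * (K * ((N : ℝ) + 3) ^ (m - i.2))) := by
          gcongr
          · exact hc i.1
          · exact hc i.2
      _ = (N + 1) * (A ^ 2 * (N + 1) * ((N : ℝ) + 3) ^ m) * K ^ 2 *
          ((N : ℝ) + 3) ^ (m - i.1 - i.2) := by
          have hp : ((N : ℝ) + 3) ^ (m - i.1) * ((N : ℝ) + 3) ^ (m - i.2) =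
              ((N : ℝ) + 3) ^ m * ((N : ℝ) + 3) ^ (m - i.1 - i.2) := by
            rw [← pow_add, ← pow_add]
            congr 1
            omega
          linear_combination A ^ 2 * ((N : ℝ) + 1) ^ 2 * K ^ 2 * hp
      _ ≤ μ * ((m + 1).factorial * 3 ^ m * (2 * m + 3)) * K ^ 2 *
          ((N : ℝ) + 3) ^ (m - i.1 - i.2) := by
          have h := Aconst_sq_mul_le N m
          rw [← hA] at h
          refine mul_le_mul_of_nonneg_right (mul_le_mul_of_nonneg_right ?_ (sq_nonneg K))
            (by positivity)
          exact mul_le_mul hμN h (by positivity) hμ0.le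
      _ = _ := by ring
  have hbound := integral_abs_sum_eval_sub_add_coordMean_le ha _
    (fun i : ℕ × ℕ => m - i.1 - i.2) _ hcoeff (by positivity)
  rw [hpli]
  rw [← sq_C_mul_gegenbauerPoly, ← hφ'] at hbound
  have h := hstein.trans hbound
  rw [mul_assoc μ, mul_assoc μ] at h
  rw [tvConst]
  exact le_of_mul_le_mul_left h hμ0

end GegenbauerBounds

theorem stmt2 (ℓ : ℕ) (hodd : Odd ℓ) (hl : 1 ≤ ℓ) :
    ∃ c > (0 : ℝ), ∀ n : ℕ, 3 ≤ n → ∀ a : Fin n → ℝ, (∑ i, (a i) ^ 2 = 1) →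
      dTV (MeasureTheory.Measure.map
            (fun x : Metric.sphere (0 : EuclideanSpace ℝ (Fin n)) 1 =>
              ∑ i, a i * pli n ℓ i x) (sphereUniform (Fin n)))
          (gaussianReal 0 1)
        ≤ c * Real.sqrt (∑ i, (a i) ^ 4) := by
  obtain ⟨q, rfl⟩ := hodd
  refine ⟨tvConst (2 * q), tvConst_pos _, fun n hn a ha => ?_⟩
  obtain ⟨N, rfl⟩ := Nat.exists_eq_add_of_le' hn
  exact dTV_sum_pli_le (even_two_mul q) N ha

end
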